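/- arXiv:2201.07027 — 15 statements merged into one kernel-verified Lean document; each statement's English description precedes it below -/
import Mathlib

section
/- Let q : Y → X be a closed quotient map from a locally compact, σ-compact Hausdorff space Y onto a Hausdorff space X. Then there exists a closed subset Z ⊆ Y such that q(Z) = X and the restriction of q to Z is an irreducible closed quotient map from Z onto X. -/
open Filter Topology Set TopologicalSpace

universe u v w

/-- A quotient map: surjective, continuous, and a set is open iff its preimage is open. -/
def IsQuotMap {Y : Type u} {X : Type v} [TopologicalSpace Y] [TopologicalSpace X]
    (q : Y → X) : Prop :=
  Function.Surjective q ∧ Continuous q ∧ ∀ s : Set X, IsOpen s ↔ IsOpen (q ⁻¹' s)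

/-- An irreducible map: no proper closed subset of the domain maps onto all of `X`. -/
def IsIrreducibleMap {Y : Type u} {X : Type v} [TopologicalSpace Y] (q : Y → X) : Prop :=
  ∀ V : Set Y, IsClosed V → q '' V = Set.univ → V = Set.univ

/-- A pure quotient map. -/
def IsPureQuotMap {Y : Type u} {X : Type v} [TopologicalSpace Y] [TopologicalSpace X]
    (q : Y → X) : Prop :=
  IsQuotMap q ∧
    ∃ D : Set Y, Dense D ∧ Set.InjOn q D ∧
      ∀ (ι : Type w) (_ : Preorder ι) (_ : Nonempty ι), IsDirected ι (· ≤ ·) →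
        ∀ d e : ι → Y, (∀ i, d i ∈ D) → (∀ i, q (d i) = q (e i)) →
          Filter.Tendsto d Filter.atTop (Filter.cocompact Y) →
          Filter.Tendsto e Filter.atTop (Filter.cocompact Y)

/-- `x` is a k-point. -/
def IsKPoint {X : Type v} [TopologicalSpace X] (x : X) : Prop :=
  ∀ E : Set X, x ∈ closure E → ∃ K : Set X, IsCompact K ∧ x ∈ closure (E ∩ K)

/-- A full subset: closed and mapping onto all of `X`. -/
def IsFull {Y : Type u} {X : Type v} [TopologicalSpace Y] (q : Y → X) (W : Set Y) : Prop :=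
  IsClosed W ∧ q '' W = Set.univ

/-- A minimal full subset. -/
def IsMinFull {Y : Type u} {X : Type v} [TopologicalSpace Y] (q : Y → X) (W : Set Y) : Prop :=
  IsFull q W ∧ ∀ Z ⊆ W, IsFull q Z → Z = W

/-- `y` is a singleton fibre of `q`. -/
def SingletonFibre {Y : Type u} {X : Type v} (q : Y → X) (y : Y) : Prop :=
  q ⁻¹' {q y} = {y}

/-- A sequentially dense subset of `X`. -/
def SeqDense {X : Type v} [TopologicalSpace X] (E : Set X) : Prop :=
  ∀ x : X, ∃ u : ℕ → X, (∀ n, u n ∈ E) ∧ Filter.Tendsto u Filter.atTop (nhds x)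

/-- A point of compact type. -/
def CompactType {X : Type v} [TopologicalSpace X] (x : X) : Prop :=
  ∃ K : Set X, IsCompact K ∧
    ∀ u : ℕ → X, Filter.Tendsto u Filter.atTop (nhds x) → ∀ᶠ n in Filter.atTop, u n ∈ K

/-- Convergence of a sequence of closed sets in the Fell topology. -/
def FellConv {Y : Type u} [TopologicalSpace Y] (F : ℕ → Set Y) (L : Set Y) : Prop :=
  (∀ U : Set Y, IsOpen U → (U ∩ L).Nonempty → ∀ᶠ n in Filter.atTop, (F n ∩ U).Nonempty) ∧
  (∀ K : Set Y, IsCompact K → K ∩ L = ∅ → ∀ᶠ n in Filter.atTop, F n ∩ K = ∅)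

/-- Membership in `C₀(Y)⁺`: continuous, nonnegative, vanishing at infinity. -/
def C0Plus {Y : Type u} [TopologicalSpace Y] (f : Y → ℝ) : Prop :=
  Continuous f ∧ (∀ y, 0 ≤ f y) ∧ ∀ ε : ℝ, 0 < ε → IsCompact {y | ε ≤ f y}

/-- `f^♯(y) = sup { f w : q w = q y }`. -/
noncomputable def fSharp {Y : Type u} {X : Type v} (q : Y → X) (f : Y → ℝ) (y : Y) : ℝ :=
  sSup (f '' (q ⁻¹' {q y}))

/-- `f^♭(x) = sup { f y : y ∈ q⁻¹(x) }`. -/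
noncomputable def fFlat {Y : Type u} {X : Type v} (q : Y → X) (f : Y → ℝ) (x : X) : ℝ :=
  sSup (f '' (q ⁻¹' {x}))

/-- Property (a). -/
def PropertyA {X : Type v} [TopologicalSpace X] (E : Set X) : Prop :=
  ∀ (x : ℕ → X) (x₀ : X), (∀ m, x m ∈ E) → Function.Injective x →
    Filter.Tendsto x Filter.atTop (nhds x₀) →
    ∃ φ : ℕ → ℕ, StrictMono φ ∧
      ∀ z : ℕ → ℕ → X, (∀ n, Filter.Tendsto (z n) Filter.atTop (nhds (x (φ n)))) →
        ∃ k : ℕ → ℕ, IsCompact (closure {p : X | ∃ n j, k n ≤ j ∧ z n j = p})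

/-- Property (b). -/
def PropertyB {X : Type v} [TopologicalSpace X] (E : Set X) : Prop :=
  ∀ (x : ℕ → X) (x₀ : X), Function.Injective x →
    Filter.Tendsto x Filter.atTop (nhds x₀) →
    ∃ φ : ℕ → ℕ, StrictMono φ ∧
      ∃ z : ℕ → ℕ → X, (∀ n j, z n j ∈ E) ∧
        (∀ n, Filter.Tendsto (z n) Filter.atTop (nhds (x (φ n)))) ∧
        ∀ js : ℕ → ℕ, Filter.Tendsto (fun n => z n (js n)) Filter.atTop (nhds x₀)

theorem closed_of_finite_inter {Y : Type u} [TopologicalSpace Y] [T2Space Y]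
    (K : CompactExhaustion Y) (T : Set Y) (hT : ∀ n, (T ∩ K n).Finite) : IsClosed T := by
  rw [← isOpen_compl_iff, isOpen_iff_mem_nhds]
  intro y hy
  obtain ⟨n, hn⟩ := K.exists_mem_nhds y
  have h1 : (T ∩ K n)ᶜ ∈ 𝓝 y :=
    (hT n).isClosed.isOpen_compl.mem_nhds (fun h => hy h.1)
  filter_upwards [hn, h1] with w hw hw1 hwT
  exact hw1 ⟨hwT, hw⟩

theorem finite_bad {Y : Type u} {X : Type v} [TopologicalSpace Y] [T2Space Y]
    [TopologicalSpace X] [T2Space X] (q : Y → X) (hc : Continuous q) (hqc : IsClosedMap q)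
    (K : CompactExhaustion Y) (n : ℕ) :
    ({x | ∀ m, ¬ q ⁻¹' {x} ⊆ K m} ∩ q '' K n).Finite := by
  by_contra hinf
  have hinf : ({x | ∀ m, ¬ q ⁻¹' {x} ⊆ K m} ∩ q '' K n).Infinite := hinf
  let x : ℕ → X := fun i => hinf.natEmbedding _ i
  have hxinj : Function.Injective x :=
    Subtype.val_injective.comp (hinf.natEmbedding _).injective
  have hx : ∀ i, x i ∈ {x | ∀ m, ¬ q ⁻¹' {x} ⊆ K m} ∩ q '' K n :=
    fun i => (hinf.natEmbedding _ i).2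
  have hz : ∀ i, ∃ z, q z = x i ∧ z ∉ K i := by
    intro i
    obtain ⟨z, h1, h2⟩ := Set.not_subset.1 ((hx i).1 i)
    exact ⟨z, h1, h2⟩
  choose z hz1 hz2 using hz
  have hcl : ∀ J : Set ℕ, IsClosed (x '' J) := by
    intro J
    have : x '' J = q '' (z '' J) := by
      rw [Set.image_image]; simp [hz1]
    rw [this]
    apply hqc
    apply closed_of_finite_inter K
    intro m
    apply ((Set.finite_lt_nat m).image z).subset
    rintro _ ⟨⟨i, -, rfl⟩, hi⟩
    refine ⟨i, ?_, rfl⟩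
    by_contra h
    exact hz2 i (K.subset (not_lt.1 h) hi)
  obtain ⟨p, -, hp⟩ := (Set.infinite_range_of_injective hxinj).exists_accPt_of_subset_isCompact
    ((K.isCompact n).image hc) (by rintro _ ⟨i, rfl⟩; exact (hx i).2)
  have hp' := accPt_iff_clusterPt.1 hp
  have h3 : p ∈ closure (Set.range x \ {p}) := by
    rw [mem_closure_iff_clusterPt]
    convert hp' using 1
    rw [Filter.inf_principal]
    congr 1
    ext; simp [and_comm]
  have h4 : Set.range x \ {p} = x '' {i | x i ≠ p} := by
    ext w; constructor
    · rintro ⟨⟨i, rfl⟩, h⟩; exact ⟨i, h, rfl⟩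
    · rintro ⟨i, h, rfl⟩; exact ⟨⟨i, rfl⟩, h⟩
  rw [h4, (hcl _).closure_eq] at h3
  obtain ⟨i, h, h'⟩ := h3
  exact h h'

theorem statement_0 {Y : Type u} {X : Type v} [TopologicalSpace Y] [T2Space Y]
    [LocallyCompactSpace Y] [SigmaCompactSpace Y] [TopologicalSpace X] [T2Space X]
    (q : Y → X) (hq : IsQuotMap q) (hqc : IsClosedMap q) :
    ∃ Z : Set Y, IsClosed Z ∧ q '' Z = Set.univ ∧
      IsQuotMap (Z.restrict q) ∧ IsClosedMap (Z.restrict q) ∧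
      IsIrreducibleMap (Z.restrict q) := by
  obtain ⟨hs, hc, -⟩ := hq
  let K : CompactExhaustion Y := default
  set D : Set X := {x | ∀ m, ¬ q ⁻¹' {x} ⊆ K m} with hD
  have hcomp : ∀ x, x ∉ D → IsCompact (q ⁻¹' {x}) := by
    intro x hx
    simp only [hD, Set.mem_setOf_eq, not_forall, not_not] at hx
    obtain ⟨m, hm⟩ := hx
    exact (K.isCompact m).of_isClosed_subset (isClosed_singleton.preimage hc) hm
  obtain ⟨M, hM⟩ := zorn_superset {M : Set Y | IsClosed M ∧ Dᶜ ⊆ q '' M} (by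
    intro c hcS hchain
    refine ⟨⋂₀ c, ⟨isClosed_sInter fun s h => (hcS h).1, ?_⟩, fun s h => Set.sInter_subset_of_mem h⟩
    intro x hx
    rcases c.eq_empty_or_nonempty with rfl | hne
    · obtain ⟨y, rfl⟩ := hs x
      exact ⟨y, by simp, rfl⟩
    have : Nonempty c := hne.to_subtype
    have key : (⋂ s : c, (q ⁻¹' {x} ∩ s.1)).Nonempty := by
      apply IsCompact.nonempty_iInter_of_directed_nonempty_isCompact_isClosed
      · intro s t
        rcases hchain.total s.2 t.2 with h | h
        · exact ⟨s, subset_rfl, Set.inter_subset_inter_right _ h⟩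
        · exact ⟨t, Set.inter_subset_inter_right _ h, subset_rfl⟩
      · intro s
        obtain ⟨y, h1, h2⟩ := (hcS s.2).2 hx
        exact ⟨y, h2, h1⟩
      · intro s
        exact (hcomp x hx).inter_right (hcS s.2).1
      · intro s
        exact (isClosed_singleton.preimage hc).inter (hcS s.2).1
    obtain ⟨y, hy⟩ := key
    rw [Set.mem_iInter] at hy
    exact ⟨y, fun s h => (hy ⟨s, h⟩).2, (hy ⟨_, hne.some_mem⟩).1⟩)
  have hMc := hM.prop.1
  have hMD := hM.prop.2
  choose z hz using hs
  have hTc : IsClosed (z '' (q '' M)ᶜ) := by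
    apply closed_of_finite_inter K
    intro n
    apply ((finite_bad q hc hqc K n).image z).subset
    rintro _ ⟨⟨x, hx, rfl⟩, hi⟩
    refine ⟨x, ⟨?_, z x, hi, hz x⟩, rfl⟩
    by_contra h
    exact hx (hMD h)
  have hZc : IsClosed (M ∪ z '' (q '' M)ᶜ) := hMc.union hTc
  have hZs : q '' (M ∪ z '' (q '' M)ᶜ) = Set.univ := by
    rw [Set.eq_univ_iff_forall]
    intro x
    by_cases h : x ∈ q '' M
    · exact Set.image_mono Set.subset_union_left h
    · exact ⟨z x, Or.inr ⟨x, h, rfl⟩, hz x⟩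
  have hrc : IsClosedMap ((M ∪ z '' (q '' M)ᶜ).restrict q) :=
    hqc.comp hZc.isClosedMap_subtype_val
  have hrs : Function.Surjective ((M ∪ z '' (q '' M)ᶜ).restrict q) := by
    intro x
    obtain ⟨y, h1, h2⟩ := hZs.ge (Set.mem_univ x)
    exact ⟨⟨y, h1⟩, h2⟩
  have hrcont : Continuous ((M ∪ z '' (q '' M)ᶜ).restrict q) := hc.comp continuous_subtype_val
  refine ⟨_, hZc, hZs, ⟨hrs, hrcont, fun s => ?_⟩, hrc, ?_⟩
  · exact ((hrc.isQuotientMap hrcont hrs).isOpen_preimage).symm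
  · intro V hV hVs
    have hV' : IsClosed (Subtype.val '' V) := hZc.isClosedMap_subtype_val _ hV
    have hsub : M ⊆ M ∩ Subtype.val '' V := by
      apply hM.le_of_le (y := M ∩ Subtype.val '' V) _ Set.inter_subset_left
      refine ⟨hMc.inter hV', ?_⟩
      intro x hx
      obtain ⟨⟨y, hy⟩, hyV, hyx⟩ := hVs.ge (Set.mem_univ x)
      change q y = x at hyx
      rcases id hy with hy' | ⟨x', hx', rfl⟩
      · exact ⟨y, ⟨hy', ⟨y, hy⟩, hyV, rfl⟩, hyx⟩
      · rw [hz] at hyx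
        subst hyx
        exact absurd (hMD hx) hx'
    rw [Set.eq_univ_iff_forall]
    rintro ⟨y, hy⟩
    rcases id hy with hy' | ⟨x, hx, rfl⟩
    · obtain ⟨-, ⟨w, hw⟩, hwV, rfl⟩ := hsub hy'
      exact hwV
    · obtain ⟨⟨w, hw⟩, hwV, hwx⟩ := hVs.ge (Set.mem_univ x)
      change q w = x at hwx
      rcases id hw with hw' | ⟨x', hx', rfl⟩
      · exact absurd ⟨w, hw', hwx⟩ hx
      · rw [hz] at hwx
        subst hwx
        exact hwV
end

section
/- Let q : Y → X be a pure quotient map from a locally compact, σ-compact Hausdorff space Y onto a Hausdorff space X. Then the following are equivalent: (1) every point of X is a k-point; (2) there exist a locally compact, σ-compact Hausdorff space Z and a closed quotient map from Z onto X; (3) there exist a locally compact, σ-compact Hausdorff space Z and an irreducible closed quotient map from Z onto X. -/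
open Filter Topology Set TopologicalSpace

universe u v w

theorem aux_finite_of_subsets_closed {X : Type v} [TopologicalSpace X] {S K : Set X}
    (hK : IsCompact K) (hSK : S ⊆ K) (h : ∀ T ⊆ S, IsClosed T) : S.Finite := by
  by_contra hS
  obtain ⟨x, -, hx⟩ := Set.Infinite.exists_accPt_of_subset_isCompact hS hK hSK
  have h1 := h (S \ {x}) sdiff_subset
  have h2 : x ∈ closure (S \ {x}) := mem_closure_iff_nhdsWithin_neBot.2 (accPt_principal_iff_nhdsWithin.1 hx)
  rw [h1.closure_eq] at h2
  exact h2.2 rfl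

theorem aux_closed_of_finite {Y : Type u} [TopologicalSpace Y] [T2Space Y]
    (K : CompactExhaustion Y) {T : Set Y} (h : ∀ m, IsClosed (T ∩ K m)) : IsClosed T := by
  refine isClosed_of_closure_subset fun y hy => ?_
  obtain ⟨n, hn⟩ := K.exists_mem_nhds y
  have : y ∈ closure (T ∩ K n) := by
    rw [mem_closure_iff_nhds] at hy ⊢
    intro t ht
    obtain ⟨z, ⟨hz1, hz2⟩, hz3⟩ := hy (t ∩ K n) (inter_mem ht hn)
    exact ⟨z, hz1, hz3, hz2⟩
  rw [(h n).closure_eq] at this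
  exact this.1

theorem aux_compact_subset {Y : Type u} {X : Type v} [TopologicalSpace Y] [T2Space Y]
    [TopologicalSpace X] [T2Space X] {q : Y → X} (hq : IsQuotMap q) (K : CompactExhaustion Y)
    {C : Set X} (hC : IsCompact C) : ∃ n, C ⊆ q '' K n := by
  by_contra! hcon
  simp only [not_subset] at hcon
  choose x hxC hx using hcon
  have hfin : ∀ m, (range x ∩ q '' K m).Finite := by
    intro m
    refine ((finite_lt_nat m).image x).subset ?_
    rintro _ ⟨⟨n, rfl⟩, hn⟩
    refine ⟨n, ?_, rfl⟩
    by_contra hnm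
    exact hx n (image_mono (K.subset (not_lt.1 hnm)) hn)
  have hcl : ∀ T ⊆ range x, IsClosed T := by
    intro T hT
    have : IsClosed (q ⁻¹' T) := by
      refine aux_closed_of_finite K fun m => ?_
      have : q ⁻¹' T ∩ K m = q ⁻¹' (T ∩ q '' K m) ∩ K m := by
        ext y; constructor
        · rintro ⟨h1, h2⟩
          exact ⟨⟨h1, y, h2, rfl⟩, h2⟩
        · rintro ⟨h1, h2⟩
          exact ⟨h1.1, h2⟩
      rw [this]
      exact (((hfin m).subset (inter_subset_inter_left _ hT)).isClosed.preimage hq.2.1).inter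
        (K.isCompact m).isClosed
    rw [← isOpen_compl_iff, hq.2.2]
    exact this.isOpen_compl
  have hS : (range x).Finite :=
    aux_finite_of_subsets_closed hC (range_subset_iff.2 hxC) hcl
  have : ∃ m, range x ⊆ q '' K m := by
    have h1 : ∀ p ∈ range x, ∃ m, p ∈ q '' K m := by
      intro p _
      obtain ⟨y, rfl⟩ := hq.1 p
      obtain ⟨m, hm⟩ := K.exists_mem y
      exact ⟨m, y, hm, rfl⟩
    choose! g hg using h1
    refine ⟨hS.toFinset.sup g, fun p hp => ?_⟩
    exact image_mono (K.subset (Finset.le_sup (hS.mem_toFinset.2 hp))) (hg p hp)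
  obtain ⟨m, hm⟩ := this
  exact hx m (hm ⟨m, rfl⟩)

theorem aux_pure {Y : Type u} {X : Type v} [TopologicalSpace Y] [T2Space Y]
    {q : Y → X} (K : CompactExhaustion Y) {D : Set Y}
    (hD : ∀ (ι : Type w) (_ : Preorder ι) (_ : Nonempty ι), IsDirected ι (· ≤ ·) →
        ∀ d e : ι → Y, (∀ i, d i ∈ D) → (∀ i, q (d i) = q (e i)) →
          Filter.Tendsto d Filter.atTop (Filter.cocompact Y) →
          Filter.Tendsto e Filter.atTop (Filter.cocompact Y))
    {C : Set Y} (hC : IsCompact C) : ∃ n, ∀ d ∈ D, q d ∈ q '' C → d ∈ K n := by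
  by_contra! hcon
  choose d hdD hdC hdK using hcon
  choose e heC he using hdC
  have hdir : IsDirected (ULift.{w} ℕ) (· ≤ ·) := inferInstance
  have := hD (ULift.{w} ℕ) inferInstance inferInstance hdir (fun i => d i.down)
    (fun i => e i.down) (fun i => hdD _) (fun i => (he _).symm) ?_
  · have h2 := this.eventually (Filter.eventually_mem_set.2 hC.compl_mem_cocompact)
    obtain ⟨i, hi⟩ := h2.exists
    exact hi (heC _)
  · rw [(hasBasis_cocompact).tendsto_right_iff]
    intro s hs
    obtain ⟨m, hm⟩ := K.exists_superset_of_isCompact hs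
    filter_upwards [eventually_ge_atTop (ULift.up m)] with i hi his
    exact hdK _ (K.subset (show m ≤ i.down from hi) (hm his))

theorem aux_closedMap {Y : Type u} {X : Type v} [TopologicalSpace Y] [T2Space Y]
    [LocallyCompactSpace Y] [SigmaCompactSpace Y] [TopologicalSpace X] [T2Space X]
    {q : Y → X} (hq : IsPureQuotMap.{u, v, w} q) (hX : ∀ x : X, IsKPoint x) : IsClosedMap q := by
  obtain ⟨hq, D, hDd, -, hD⟩ := hq
  have K : CompactExhaustion Y := default
  intro F hF
  refine isClosed_of_closure_subset fun x hx => ?_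
  by_contra hxF
  have hdis : Disjoint F (q ⁻¹' {x}) := by
    rw [Set.disjoint_left]
    rintro y hy rfl
    exact hxF ⟨y, hy, rfl⟩
  obtain ⟨U, hU, hFU, hUx⟩ := normal_exists_closure_subset hF
    (isClosed_singleton.preimage hq.2.1 : IsClosed (q ⁻¹' {x})).isOpen_compl
    hdis.subset_compl_right
  have h1 : x ∈ closure (q '' (U ∩ D)) := by
    refine closure_minimal ?_ isClosed_closure hx
    rintro _ ⟨y, hy, rfl⟩
    exact image_closure_subset_closure_image hq.2.1
      ⟨y, hDd.open_subset_closure_inter hU (hFU hy), rfl⟩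
  obtain ⟨C, hC, hxC⟩ := hX x _ h1
  obtain ⟨n, hn⟩ := aux_compact_subset hq K hC
  obtain ⟨m, hm⟩ := aux_pure K hD (K.isCompact n)
  have hcl : IsClosed (q '' (closure U ∩ K m)) :=
    (((K.isCompact m).inter_left isClosed_closure).image hq.2.1).isClosed
  have : x ∈ q '' (closure U ∩ K m) := by
    refine closure_minimal ?_ hcl hxC
    rintro _ ⟨⟨y, ⟨hyU, hyD⟩, rfl⟩, hyC⟩
    exact ⟨y, ⟨subset_closure hyU, hm y hyD (hn hyC)⟩, rfl⟩
  obtain ⟨y, ⟨hy, -⟩, rfl⟩ := this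
  exact hUx hy rfl

theorem aux_key {Y : Type u} {X : Type v} [TopologicalSpace Y] [T2Space Y]
    [LocallyCompactSpace Y] [TopologicalSpace X] [T2Space X]
    {q : Y → X} (K : CompactExhaustion Y) (hs : Function.Surjective q) (hc : Continuous q)
    (hcl : IsClosedMap q) {D : Set Y} (hDd : Dense D) (hDi : InjOn q D) (x : X) :
    ∃ n, ∀ W, IsFull q W → (W ∩ (K n ∩ q ⁻¹' {x})).Nonempty := by
  by_cases h : ∃ f, q f = x ∧ ∀ U ∈ 𝓝 f, ∃ d ∈ U, q d ≠ x
  · obtain ⟨f, hf, hU⟩ := h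
    by_contra! hcon
    choose W hW hWK using hcon
    obtain ⟨N, hN, hNf⟩ := exists_compact_mem_nhds f
    obtain ⟨w, hw, hww⟩ := exists_seq_of_forall_finset_exists
      (fun w : Y => q w ≠ x ∧ q w ∈ q '' N) (fun w w' => K.find w < K.find w' ∧ q w ≠ q w') (by
        intro s hsP
        set n := s.sup K.find with hn
        have hO : IsOpen (q '' (W n ∩ K n) ∪ q '' (s : Set Y))ᶜ :=
          ((hcl _ ((hW n).1.inter (K.isCompact n).isClosed)).union
            ((s.finite_toSet.image q).isClosed)).isOpen_compl
        have hxO : f ∈ q ⁻¹' (q '' (W n ∩ K n) ∪ q '' (s : Set Y))ᶜ := by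
          rintro (⟨y, ⟨hy1, hy2⟩, hy⟩ | ⟨y, hy1, hy⟩)
          · have : y ∈ W n ∩ (K n ∩ q ⁻¹' {x}) := ⟨hy1, hy2, hy.trans hf⟩
            rw [hWK n] at this
            exact this
          · exact (hsP y hy1).1 (hy.trans hf)
        obtain ⟨d, ⟨hdN, hdO⟩, hdx⟩ := hU _ (inter_mem hNf ((hO.preimage hc).mem_nhds hxO))
        obtain ⟨w, hwW, hwd⟩ : q d ∈ q '' W n := by rw [(hW n).2]; trivial
        refine ⟨w, ⟨hwd ▸ hdx, hwd ▸ ⟨d, hdN, rfl⟩⟩, fun y hy => ⟨?_, ?_⟩⟩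
        · have h1 : w ∉ K n := fun h => hdO (Or.inl ⟨w, ⟨hwW, h⟩, hwd⟩)
          rw [K.mem_iff_find_le, not_le] at h1
          exact lt_of_le_of_lt (Finset.le_sup hy) h1
        · intro h
          exact hdO (Or.inr ⟨y, hy, h.trans hwd⟩))
    have hmono : StrictMono (fun n => K.find (w n)) := fun m n hmn => (hww m n hmn).1
    have hinj : Function.Injective (fun n => q (w n)) :=
      fun m n hmn => by
        rcases lt_trichotomy m n with h | h | h
        · exact absurd hmn (hww m n h).2
        · exact h
        · exact absurd hmn.symm (hww n m h).2
    have hfin : (range fun n => q (w n)).Finite := by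
      refine aux_finite_of_subsets_closed (hN.image hc) (range_subset_iff.2 fun n => (hw n).2) ?_
      intro T hT
      have : T = q '' (range w ∩ q ⁻¹' T) := by
        ext t; constructor
        · intro ht
          obtain ⟨n, rfl⟩ := hT ht
          exact ⟨w n, ⟨⟨n, rfl⟩, ht⟩, rfl⟩
        · rintro ⟨_, ⟨-, h⟩, rfl⟩
          exact h
      rw [this]
      refine hcl _ (aux_closed_of_finite K fun m => Set.Finite.isClosed ?_)
      refine ((finite_le_nat m).image w).subset ?_
      rintro _ ⟨⟨⟨n, rfl⟩, -⟩, hn⟩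
      refine ⟨n, ?_, rfl⟩
      rw [K.mem_iff_find_le] at hn
      exact (hmono.le_apply (x := n)).trans hn
    exact infinite_range_of_injective hinj hfin
  · push Not at h
    have hopen : IsOpen (q ⁻¹' {x}) := by
      rw [isOpen_iff_mem_nhds]
      intro f hf
      obtain ⟨U, hU, hUx⟩ := h f hf
      exact mem_of_superset hU hUx
    have hsub : (q ⁻¹' {x} ∩ D).Subsingleton := by
      rintro a ⟨ha, haD⟩ b ⟨hb, hbD⟩
      exact hDi haD hbD (Eq.trans ha (Eq.symm hb))
    have h2 : q ⁻¹' {x} ⊆ q ⁻¹' {x} ∩ D := by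
      have := hDd.open_subset_closure_inter hopen
      rwa [hsub.isClosed.closure_eq] at this
    obtain ⟨f, hf⟩ := hs x
    obtain ⟨n, hn⟩ := K.exists_mem f
    refine ⟨n, fun W hW => ?_⟩
    obtain ⟨w, hwW, hw⟩ : x ∈ q '' W := by rw [hW.2]; trivial
    have : w = f := hsub (h2 hw) (h2 hf)
    exact ⟨w, hwW, this ▸ hn, hw⟩

theorem aux_minFull {Y : Type u} {X : Type v} [TopologicalSpace Y] [T2Space Y]
    [LocallyCompactSpace Y] [TopologicalSpace X] [T2Space X]
    {q : Y → X} (K : CompactExhaustion Y) (hs : Function.Surjective q) (hc : Continuous q)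
    (hcl : IsClosedMap q) {D : Set Y} (hDd : Dense D) (hDi : InjOn q D) :
    ∃ W, IsMinFull q W := by
  obtain ⟨W, hW⟩ := zorn_superset {W | IsFull q W} (by
    intro c hcS hch
    by_cases hne : c.Nonempty
    · refine ⟨⋂₀ c, ⟨isClosed_sInter fun W hW => (hcS hW).1, ?_⟩, fun s hs => sInter_subset_of_mem hs⟩
      refine eq_univ_of_forall fun x => ?_
      obtain ⟨n, hn⟩ := aux_key K hs hc hcl hDd hDi x
      have : Nonempty c := hne.coe_sort
      have hF : IsClosed (q ⁻¹' {x}) := isClosed_singleton.preimage hc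
      obtain ⟨y, hy⟩ := IsCompact.nonempty_iInter_of_directed_nonempty_isCompact_isClosed
        (fun W : c => (W : Set Y) ∩ (K n ∩ q ⁻¹' {x})) (by
          rintro ⟨A, hA⟩ ⟨B, hB⟩
          rcases hch.total hA hB with h | h
          · exact ⟨⟨A, hA⟩, Subset.rfl, inter_subset_inter_left _ h⟩
          · exact ⟨⟨B, hB⟩, inter_subset_inter_left _ h, Subset.rfl⟩)
        (fun W => hn _ (hcS W.2))
        (fun W => ((K.isCompact n).inter_right hF).inter_left (hcS W.2).1)
        (fun W => (hcS W.2).1.inter ((K.isCompact n).isClosed.inter hF))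
      rw [mem_iInter] at hy
      obtain ⟨W0⟩ := this
      exact ⟨y, fun W hW => (hy ⟨W, hW⟩).1, (hy W0).2.2⟩
    · rw [not_nonempty_iff_eq_empty] at hne
      subst hne
      exact ⟨univ, ⟨isClosed_univ, by rw [image_univ, hs.range_eq]⟩, fun s hs => absurd hs (by simp)⟩)
  exact ⟨W, hW.prop, fun Z hZ hZf => Subset.antisymm hZ (hW.le_of_le hZf hZ)⟩

theorem aux_small {Y : Type u} {X : Type v} [TopologicalSpace Y] [T2Space Y]
    {q : Y → X} {D : Set Y} (hDd : Dense D) (hDi : InjOn q D) : Small.{v} Y := by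
  refine small_of_injective (β := Set (Set X))
    (f := fun y => {A | y ∈ closure (D ∩ q ⁻¹' A)}) ?_
  intro y y' h
  by_contra hne
  obtain ⟨U, V, hU, hV, hyU, hyV, hUV⟩ := t2_separation hne
  have h1 : D ∩ q ⁻¹' (q '' (D ∩ U)) = D ∩ U := by
    ext d; constructor
    · rintro ⟨hd, d', ⟨hd', hU'⟩, he⟩
      rw [hDi hd' hd he] at hU'
      exact ⟨hd, hU'⟩
    · rintro ⟨hd, hdU⟩
      exact ⟨hd, d, ⟨hd, hdU⟩, rfl⟩
  have h2 : q '' (D ∩ U) ∈ {A | y ∈ closure (D ∩ q ⁻¹' A)} := by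
    rw [mem_ofPred_eq, h1, inter_comm]
    exact hDd.open_subset_closure_inter hU hyU
  simp only at h
  rw [h, mem_ofPred_eq, h1] at h2
  obtain ⟨z, hz1, hz2⟩ := mem_closure_iff.1 h2 V hV hyV
  exact Set.disjoint_left.1 hUV hz2.2 hz1

theorem aux_quot {Z : Type u} {X : Type v} [TopologicalSpace Z] [TopologicalSpace X]
    {p : Z → X} (hs : Function.Surjective p) (hc : Continuous p) (hcl : IsClosedMap p) :
    IsQuotMap p :=
  ⟨hs, hc, fun _ => ((hcl.isQuotientMap hc hs).isOpen_preimage).symm⟩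

theorem aux_one_three {Y : Type u} {X : Type v} [TopologicalSpace Y] [T2Space Y]
    [LocallyCompactSpace Y] [SigmaCompactSpace Y] [TopologicalSpace X] [T2Space X]
    (q : Y → X) (hq : IsPureQuotMap.{u, v, w} q) (hX : ∀ x : X, IsKPoint x) :
    ∃ (Z : Type v) (_ : TopologicalSpace Z), T2Space Z ∧ LocallyCompactSpace Z ∧
        SigmaCompactSpace Z ∧
        ∃ p : Z → X, IsQuotMap p ∧ IsClosedMap p ∧ IsIrreducibleMap p := by
  have hcl := aux_closedMap hq hX
  obtain ⟨hq, D, hDd, hDi, -⟩ := hq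
  have K : CompactExhaustion Y := default
  obtain ⟨W, hW, hmin⟩ := aux_minFull K hq.1 hq.2.1 hcl hDd hDi
  have := aux_small hDd hDi
  let e : Shrink.{v} W ≃ₜ W := (Shrink.homeomorph W).symm
  have he : IsClosedEmbedding (fun z => (e z : Y)) :=
    hW.1.isClosedEmbedding_subtypeVal.comp e.isClosedEmbedding
  have hr : range (fun z => (e z : Y)) = W := by
    rw [show (fun z => (e z : Y)) = Subtype.val ∘ e from rfl, range_comp, e.surjective.range_eq]
    simp
  have hsurj : Function.Surjective (fun z => q (e z)) := by
    intro x
    obtain ⟨w, hw, rfl⟩ : x ∈ q '' W := by rw [hW.2]; trivial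
    exact ⟨e.symm ⟨w, hw⟩, by simp⟩
  have hcl' : IsClosedMap (fun z => q (e z)) := hcl.comp he.isClosedMap
  refine ⟨Shrink.{v} W, inferInstance, he.isEmbedding.t2Space, he.locallyCompactSpace,
    he.sigmaCompactSpace, fun z => q (e z), aux_quot hsurj (hq.2.1.comp he.continuous) hcl',
    hcl', ?_⟩
  intro V hV hVX
  have h1 : (fun z => (e z : Y)) '' V = W := by
    refine hmin _ ?_ ⟨he.isClosedMap _ hV, by rw [image_image]; exact hVX⟩
    exact (image_subset_range _ _).trans hr.subset
  have h2 := h1.trans (hr.symm.trans image_univ.symm)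
  exact he.injective.image_injective h2

theorem aux_two_one {Z : Type v} {X : Type v} [TopologicalSpace Z]
    [LocallyCompactSpace Z] [TopologicalSpace X]
    {p : Z → X} (hp : IsQuotMap p) (hcl : IsClosedMap p) (x : X) : IsKPoint x := by
  intro E hE
  have : x ∈ p '' closure (p ⁻¹' E) := by
    refine closure_minimal ?_ (hcl _ isClosed_closure) hE
    intro y hy
    obtain ⟨z, rfl⟩ := hp.1 y
    exact ⟨z, subset_closure hy, rfl⟩
  obtain ⟨z, hz, rfl⟩ := this
  obtain ⟨N, hN, hNz⟩ := exists_compact_mem_nhds z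
  refine ⟨p '' N, hN.image hp.2.1, ?_⟩
  have h1 : z ∈ closure (p ⁻¹' E ∩ N) := by
    rw [mem_closure_iff_nhds] at hz ⊢
    intro t ht
    obtain ⟨y, ⟨hy1, hy2⟩, hy3⟩ := hz (t ∩ N) (inter_mem ht hNz)
    exact ⟨y, hy1, hy3, hy2⟩
  refine closure_mono ?_ (image_closure_subset_closure_image hp.2.1 ⟨z, h1, rfl⟩)
  rintro _ ⟨y, ⟨hy1, hy2⟩, rfl⟩
  exact ⟨hy1, y, hy2, rfl⟩

theorem statement_1 {Y : Type u} {X : Type v} [TopologicalSpace Y] [T2Space Y]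
    [LocallyCompactSpace Y] [SigmaCompactSpace Y] [TopologicalSpace X] [T2Space X]
    (q : Y → X) (hq : IsPureQuotMap.{u, v, w} q) :
    ((∀ x : X, IsKPoint x) ↔
      (∃ (Z : Type v) (_ : TopologicalSpace Z), T2Space Z ∧ LocallyCompactSpace Z ∧
        SigmaCompactSpace Z ∧ ∃ p : Z → X, IsQuotMap p ∧ IsClosedMap p)) ∧
    ((∃ (Z : Type v) (_ : TopologicalSpace Z), T2Space Z ∧ LocallyCompactSpace Z ∧
        SigmaCompactSpace Z ∧ ∃ p : Z → X, IsQuotMap p ∧ IsClosedMap p) ↔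
      (∃ (Z : Type v) (_ : TopologicalSpace Z), T2Space Z ∧ LocallyCompactSpace Z ∧
        SigmaCompactSpace Z ∧
        ∃ p : Z → X, IsQuotMap p ∧ IsClosedMap p ∧ IsIrreducibleMap p)) := by
  have h32 : (∃ (Z : Type v) (_ : TopologicalSpace Z), T2Space Z ∧ LocallyCompactSpace Z ∧
        SigmaCompactSpace Z ∧
        ∃ p : Z → X, IsQuotMap p ∧ IsClosedMap p ∧ IsIrreducibleMap p) →
      (∃ (Z : Type v) (_ : TopologicalSpace Z), T2Space Z ∧ LocallyCompactSpace Z ∧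
        SigmaCompactSpace Z ∧ ∃ p : Z → X, IsQuotMap p ∧ IsClosedMap p) := by
    rintro ⟨Z, tZ, h1, h2, h3, p, h4, h5, -⟩
    exact ⟨Z, tZ, h1, h2, h3, p, h4, h5⟩
  have h21 : (∃ (Z : Type v) (_ : TopologicalSpace Z), T2Space Z ∧ LocallyCompactSpace Z ∧
        SigmaCompactSpace Z ∧ ∃ p : Z → X, IsQuotMap p ∧ IsClosedMap p) →
      ∀ x : X, IsKPoint x := by
    rintro ⟨Z, tZ, h1, h2, h3, p, h4, h5⟩ x
    exact aux_two_one h4 h5 x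
  have h13 := aux_one_three q hq
  exact ⟨⟨fun h => h32 (h13 h), h21⟩, ⟨fun h => h13 (h21 h), h32⟩⟩
end

section
/- Let Y be a locally compact, separable metric space and q : Y → X a continuous surjective map with X Hausdorff. For each continuous function f : Y → ℝ with f ≥ 0 vanishing at infinity, define f^♯ : Y → ℝ by f^♯(y) = sup{f(w) : w ∈ Y, q(w) = q(y)}. Then there is a dense G_δ subset G of Y such that for every such f, the function f^♯ is continuous at every point of G. -/
open Filter Topology Set TopologicalSpace

universe u v w

theorem c0plus_bddAbove {Y : Type u} [TopologicalSpace Y] {f : Y → ℝ} (hf : C0Plus f)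
    (s : Set Y) : BddAbove (f '' s) := by
  obtain ⟨M, hM⟩ := (hf.2.2 1 one_pos).bddAbove_image hf.1.continuousOn
  refine ⟨max M 1, ?_⟩
  rintro _ ⟨y, -, rfl⟩
  by_cases h : 1 ≤ f y
  · exact le_max_of_le_left (hM ⟨y, h, rfl⟩)
  · exact le_max_of_le_right (le_of_not_ge h)

theorem statement_3 {Y : Type u} {X : Type v} [MetricSpace Y] [LocallyCompactSpace Y]
    [SeparableSpace Y] [TopologicalSpace X] [T2Space X]
    (q : Y → X) (hqc : Continuous q) (hqs : Function.Surjective q) :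
    ∃ G : Set Y, Dense G ∧ IsGδ G ∧
      ∀ f : Y → ℝ, C0Plus f → ∀ y ∈ G, ContinuousAt (fSharp q f) y := by
  haveI : SecondCountableTopology Y := UniformSpace.secondCountable_of_separable Y
  let B := countableBasis Y
  let C : Set (Set Y) := {b ∈ B | IsCompact (closure b)}
  have hC : C.Countable := (countable_countableBasis Y).mono (fun b hb => hb.1)
  have hS : ∀ K : Set Y, IsCompact K → IsClosed (q ⁻¹' (q '' K)) := fun K hK =>
    (hK.image hqc).isClosed.preimage hqc
  have hopen : ∀ b ∈ C, IsOpen (frontier (q ⁻¹' (q '' closure b)))ᶜ := fun b _ =>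
    isClosed_frontier.isOpen_compl
  refine ⟨⋂ b ∈ C, (frontier (q ⁻¹' (q '' closure b)))ᶜ, ?_, ?_, ?_⟩
  · refine dense_biInter_of_isOpen hopen hC ?_
    intro b hb
    exact interior_eq_empty_iff_dense_compl.1 (interior_frontier (hS _ hb.2))
  · exact IsGδ.biInter hC fun b hb => (hopen b hb).isGδ
  · intro f hf y hy
    have hle : ∀ z w, q w = q z → f w ≤ fSharp q f z := fun z w h =>
      le_csSup (c0plus_bddAbove hf _) ⟨w, h, rfl⟩
    have hne : ∀ z, (f '' (q ⁻¹' {q z})).Nonempty := fun z => ⟨f z, z, rfl, rfl⟩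
    refine tendsto_order.2 ⟨?_, ?_⟩
    · intro c hc
      obtain ⟨_, ⟨w, hw, rfl⟩, hcw⟩ := exists_lt_of_lt_csSup (hne y) hc
      have hU : {z | c < f z} ∈ 𝓝 w := (isOpen_lt continuous_const hf.1).mem_nhds hcw
      obtain ⟨K, hK, hKU, hKc⟩ := local_compact_nhds hU
      obtain ⟨b, hb, hwb, hbK⟩ := (isBasis_countableBasis Y).mem_nhds_iff.1 hK
      have hcl : closure b ⊆ K := closure_minimal hbK hKc.isClosed
      have hbC : b ∈ C := ⟨hb, hKc.of_isClosed_subset isClosed_closure hcl⟩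
      have hyf := mem_iInter₂.1 hy b hbC
      have hyS : y ∈ q ⁻¹' (q '' closure b) := ⟨w, subset_closure hwb, hw⟩
      have hyi : y ∈ interior (q ⁻¹' (q '' closure b)) := by
        by_contra h
        exact hyf ⟨subset_closure hyS, h⟩
      filter_upwards [mem_interior_iff_mem_nhds.1 hyi] with z hz
      obtain ⟨v, hv, hvz⟩ := hz
      exact lt_of_lt_of_le (hKU (hcl hv)) (hle z v hvz)
    · intro c hc
      obtain ⟨d, hd, hdc⟩ := exists_between hc
      have hd0 : 0 < d := lt_of_le_of_lt ((hf.2.1 y).trans (hle y y rfl)) hd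
      have hcl := hS _ (hf.2.2 d hd0)
      have hyn : y ∈ (q ⁻¹' (q '' {z | d ≤ f z}))ᶜ := by
        rintro ⟨w, hw, hwy⟩
        exact absurd (hle y w hwy) (not_le.2 (hd.trans_le hw))
      filter_upwards [hcl.isOpen_compl.mem_nhds hyn] with z hz
      refine lt_of_le_of_lt (csSup_le (hne z) ?_) hdc
      rintro _ ⟨w, hw, rfl⟩
      by_contra h
      exact hz ⟨w, (not_le.1 h).le, hw⟩
end

section
/- Let Y be a locally compact, separable metric space and q : Y → X a continuous surjective map with X Hausdorff. For f ∈ C₀(Y)⁺ define f^♯ : Y → ℝ by f^♯(y) = sup{f(w) : w ∈ Y, q(w) = q(y)}. Let y₀ ∈ Y and set F₀ = q⁻¹(q(y₀)). Then every f^♯ (f ∈ C₀(Y)⁺) is continuous at y₀ if and only if whenever (F_n) is a sequence of fibres of q (sets of the form q⁻¹(x), x ∈ X) converging in the Fell topology to a closed set F ⊆ Y with y₀ ∈ F, one has F = F₀. -/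
open Filter Topology Set TopologicalSpace

universe u v w

lemma bddAbove_of_C0Plus {Y : Type u} [TopologicalSpace Y] {f : Y → ℝ} (hf : C0Plus f) :
    BddAbove (range f) := by
  obtain ⟨hc, h0, hK⟩ := hf
  obtain ⟨M, hM⟩ := (hK 1 one_pos).bddAbove_image hc.continuousOn
  refine ⟨max M 1, ?_⟩
  rintro _ ⟨y, rfl⟩
  by_cases h : 1 ≤ f y
  · exact le_max_of_le_left (hM ⟨y, h, rfl⟩)
  · exact le_max_of_le_right (not_le.1 h).le

lemma fell_subseq {Y : Type u} [TopologicalSpace Y] [SecondCountableTopology Y]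
    (F : ℕ → Set Y) : ∃ (φ : ℕ → ℕ) (L : Set Y), StrictMono φ ∧ IsClosed L ∧
      FellConv (fun n => F (φ n)) L := by
  classical
  let B := countableBasis Y
  have hB : IsTopologicalBasis B := isBasis_countableBasis Y
  haveI : Countable B := (countable_countableBasis Y).to_subtype
  let g : ℕ → (B → Bool) := fun n b => decide ((F n ∩ b.1).Nonempty)
  obtain ⟨a, -, φ, hφ, ha⟩ :=
    (isCompact_univ : IsCompact (univ : Set (B → Bool))).tendsto_subseq (x := g)
      (fun n => mem_univ _)
  have key : ∀ b : B, ∀ᶠ n in atTop, g (φ n) b = a b := by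
    intro b
    have h := (tendsto_pi_nhds.1 ha) b
    rw [nhds_discrete, tendsto_pure] at h
    exact h
  refine ⟨φ, {y | ∀ b : B, y ∈ b.1 → a b = true}, hφ, ?_, ?_, ?_⟩
  · have : {y : Y | ∀ b : B, y ∈ b.1 → a b = true} = ⋂ b : B, ⋂ _ : a b = false, (b.1)ᶜ := by
      ext y
      simp only [mem_setOf_eq, mem_iInter, mem_compl_iff]
      refine forall_congr' fun b => ?_
      cases a b <;> simp
    rw [this]
    exact isClosed_iInter fun b => isClosed_iInter fun _ => (hB.isOpen b.2).isClosed_compl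
  · rintro U hU ⟨y, hyU, hyL⟩
    obtain ⟨b, hb, hyb, hbU⟩ := hB.exists_subset_of_mem_open hyU hU
    have h1 := hyL ⟨b, hb⟩ hyb
    filter_upwards [key ⟨b, hb⟩] with n hn
    rw [h1] at hn
    have h2 : (F (φ n) ∩ b).Nonempty := by simpa [g] using hn
    exact h2.mono (inter_subset_inter_right _ hbU)
  · intro K hK hKL
    refine hK.induction_on (p := fun s => ∀ᶠ n in atTop, F (φ n) ∩ s = ∅) ?_ ?_ ?_ ?_
    · simp
    · intro s t hst ht
      filter_upwards [ht] with n hn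
      exact subset_empty_iff.1 (hn ▸ inter_subset_inter_right _ hst)
    · intro s t hs ht
      filter_upwards [hs, ht] with n h1 h2
      rw [inter_union_distrib_left, h1, h2, union_empty]
    · intro y hy
      have hyL : ¬ ∀ b : B, y ∈ b.1 → a b = true := fun h =>
        (hKL ▸ (⟨hy, h⟩ : y ∈ K ∩ {y | ∀ b : B, y ∈ b.1 → a b = true}) : y ∈ (∅ : Set Y))
      push Not at hyL
      obtain ⟨b, hyb, hab⟩ := hyL
      refine ⟨b.1, mem_nhdsWithin_of_mem_nhds ((hB.isOpen b.2).mem_nhds hyb), ?_⟩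
      filter_upwards [key b] with n hn
      have hab' : a b = false := by simpa using hab
      rw [hab'] at hn
      have : ¬ (F (φ n) ∩ b.1).Nonempty := by simpa [g] using hn
      exact not_nonempty_iff_eq_empty.1 this

theorem statement_4 {Y : Type u} {X : Type v} [MetricSpace Y] [LocallyCompactSpace Y]
    [SeparableSpace Y] [TopologicalSpace X] [T2Space X]
    (q : Y → X) (hqc : Continuous q) (hqs : Function.Surjective q) (y₀ : Y) :
    (∀ f : Y → ℝ, C0Plus f → ContinuousAt (fSharp q f) y₀) ↔
      (∀ (F : ℕ → Set Y) (L : Set Y), (∀ n, ∃ x : X, F n = q ⁻¹' {x}) → IsClosed L →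
        FellConv F L → y₀ ∈ L → L = q ⁻¹' {q y₀}) := by
  haveI : SecondCountableTopology Y := UniformSpace.secondCountable_of_separable Y
  constructor
  · intro H F L hF hL hFL hy
    apply Subset.antisymm
    · intro w hw
      by_contra hne
      obtain ⟨U, V, hU, hV, hwU, hyV, hUV⟩ := t2_separation (show q w ≠ q y₀ from hne)
      have h1 := hFL.1 _ (hU.preimage hqc) ⟨w, hwU, hw⟩
      have h2 := hFL.1 _ (hV.preimage hqc) ⟨y₀, hyV, hy⟩
      obtain ⟨n, ⟨a, haF, haU⟩, ⟨b, hbF, hbV⟩⟩ := (h1.and h2).exists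
      obtain ⟨x, hx⟩ := hF n
      rw [hx] at haF hbF
      have ha : q a = x := haF
      have hb : q b = x := hbF
      have haU' : q a ∈ U := haU
      have hbV' : q b ∈ V := hbV
      rw [ha] at haU'
      rw [hb] at hbV'
      exact disjoint_left.1 hUV haU' hbV'
    · intro w hw
      by_contra hwL
      obtain ⟨K, hwK, hKL, hK⟩ := local_compact_nhds (hL.isOpen_compl.mem_nhds hwL)
      obtain ⟨f, hf1, hf0, hfc, hf01⟩ := exists_continuous_one_zero_of_isCompact
        (isCompact_singleton (x := w)) (isOpen_interior (s := K)).isClosed_compl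
        (disjoint_singleton_left.2 (fun h => h (mem_interior_iff_mem_nhds.2 hwK)))
      have hfK : ∀ y, y ∉ K → f y = 0 := fun y hy => hf0 (fun h => hy (interior_subset h))
      have hC : C0Plus (f : Y → ℝ) := by
        refine ⟨f.continuous, fun y => (hf01 y).1, fun ε hε => ?_⟩
        refine hK.of_isClosed_subset (isClosed_le continuous_const f.continuous) ?_
        intro y hy
        by_contra hyK
        have : ε ≤ f y := hy
        rw [hfK y hyK] at this
        linarith
      have hbd := bddAbove_of_C0Plus hC
      have h1 : (1 : ℝ) ≤ fSharp q f y₀ := by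
        have : f w = 1 := hf1 (mem_singleton w)
        rw [← this]
        exact le_csSup (hbd.mono (image_subset_range _ _)) ⟨w, hw, rfl⟩
      have h2 : ∀ᶠ y in 𝓝 y₀, (0 : ℝ) < fSharp q f y :=
        (H f hC).eventually (lt_mem_nhds (by linarith))
      obtain ⟨U, hUs, hU, hyU⟩ := eventually_nhds_iff.1 h2
      have h3 := hFL.1 U hU ⟨y₀, hyU, hy⟩
      have h4 := hFL.2 K hK (disjoint_iff_inter_eq_empty.1 (disjoint_left.2 hKL))
      obtain ⟨n, ⟨a, haF, haU⟩, hn⟩ := (h3.and h4).exists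
      obtain ⟨x, hx⟩ := hF n
      have hax : q a = x := by rw [hx] at haF; exact haF
      have h5 := hUs a haU
      have h6 : fSharp q f a ≤ 0 := by
        refine Real.sSup_le ?_ le_rfl
        rintro _ ⟨z, hz, rfl⟩
        refine (hfK z fun hzK => ?_).le
        have : z ∈ F n ∩ K := ⟨by rw [hx, ← hax]; exact hz, hzK⟩
        rw [hn] at this
        exact this
      linarith
  · intro H f hf
    have hbd := bddAbove_of_C0Plus hf
    by_contra hcon
    rw [Metric.continuousAt_iff] at hcon
    push Not at hcon
    obtain ⟨ε, hε, hcon⟩ := hcon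
    choose y hy1 hy2 using fun n : ℕ => hcon (1 / ((n : ℝ) + 1)) (by positivity)
    have hylim : Tendsto y atTop (𝓝 y₀) := by
      rw [tendsto_iff_dist_tendsto_zero]
      exact squeeze_zero (fun _ => dist_nonneg) (fun n => (hy1 n).le)
        tendsto_one_div_add_atTop_nhds_zero_nat
    obtain ⟨φ, L, hφ, hL, hFL⟩ := fell_subseq (fun n => q ⁻¹' {q (y n)})
    have hyφ : Tendsto (fun n => y (φ n)) atTop (𝓝 y₀) := hylim.comp hφ.tendsto_atTop
    have hyL : y₀ ∈ L := by
      by_contra hyL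
      obtain ⟨K, hwK, hKL, hK⟩ := local_compact_nhds (hL.isOpen_compl.mem_nhds hyL)
      have h4 := hFL.2 K hK (disjoint_iff_inter_eq_empty.1 (disjoint_left.2 hKL))
      obtain ⟨n, hn, hn'⟩ := (h4.and (hyφ.eventually_mem hwK)).exists
      have : y (φ n) ∈ (∅ : Set Y) := hn ▸ ⟨rfl, hn'⟩
      exact this
    have hL0 := H _ L (fun n => ⟨_, rfl⟩) hL hFL hyL
    subst hL0
    have hlow : ∀ᶠ n in atTop, fSharp q f y₀ - ε < fSharp q f (y (φ n)) := by
      obtain ⟨_, ⟨w, hw, rfl⟩, hw2⟩ := exists_lt_of_lt_csSup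
        (s := f '' (q ⁻¹' {q y₀})) ⟨_, y₀, rfl, rfl⟩
        (show fSharp q f y₀ - ε < sSup (f '' (q ⁻¹' {q y₀})) by
          change fSharp q f y₀ - ε < fSharp q f y₀; linarith)
      filter_upwards [hFL.1 _ (isOpen_lt continuous_const hf.1) ⟨w, hw2, hw⟩]
      rintro n ⟨z, hz, hz2⟩
      exact lt_of_lt_of_le hz2 (le_csSup (hbd.mono (image_subset_range _ _)) ⟨z, hz, rfl⟩)
    have h0 : 0 ≤ fSharp q f y₀ := by
      apply Real.sSup_nonneg
      rintro _ ⟨z, -, rfl⟩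
      exact hf.2.1 z
    have hup : ∀ᶠ n in atTop, fSharp q f (y (φ n)) ≤ fSharp q f y₀ + ε / 2 := by
      have hd : {z | fSharp q f y₀ + ε / 2 ≤ f z} ∩ q ⁻¹' {q y₀} = ∅ := by
        rw [eq_empty_iff_forall_notMem]
        rintro z ⟨hz1, hz2⟩
        have h3 : f z ≤ fSharp q f y₀ :=
          le_csSup (hbd.mono (image_subset_range _ _)) ⟨z, hz2, rfl⟩
        have h4 : fSharp q f y₀ + ε / 2 ≤ f z := hz1
        linarith
      filter_upwards [hFL.2 _ (hf.2.2 (fSharp q f y₀ + ε / 2) (by linarith)) hd] with n hn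
      refine csSup_le ⟨_, y (φ n), rfl, rfl⟩ ?_
      rintro _ ⟨z, hz, rfl⟩
      by_contra hlt
      have : z ∈ (∅ : Set Y) := hn ▸ ⟨hz, (not_le.1 hlt).le⟩
      exact this
    obtain ⟨n, h1, h2⟩ := (hlow.and hup).exists
    have h3 := hy2 (φ n)
    rw [Real.dist_eq] at h3
    have : |fSharp q f (y (φ n)) - fSharp q f y₀| < ε := abs_lt.2 ⟨by linarith, by linarith⟩
    linarith
end

section
/- Let Y be a locally compact, separable metric space and q : Y → X a continuous surjective map with X Hausdorff. If q is irreducible, then for every nonempty open set U ⊆ Y and every n ∈ ℕ with n ≥ 1, there is a point x ∈ X such that the fibre F = q⁻¹(x) is compact, contained in U, and has diameter less than 1/n. -/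
open Filter Topology Set TopologicalSpace

universe u v w

theorem statement_5 {Y : Type u} {X : Type v} [MetricSpace Y] [LocallyCompactSpace Y]
    [SeparableSpace Y] [TopologicalSpace X] [T2Space X]
    (q : Y → X) (hqc : Continuous q) (hqs : Function.Surjective q)
    (hirr : IsIrreducibleMap q) :
    ∀ U : Set Y, IsOpen U → U.Nonempty → ∀ n : ℕ, 1 ≤ n →
      ∃ x : X, IsCompact (q ⁻¹' {x}) ∧ q ⁻¹' {x} ⊆ U ∧
        Metric.diam (q ⁻¹' {x}) < 1 / (n : ℝ) := by
  intro U hU ⟨y, hy⟩ n hn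
  have hn' : (0 : ℝ) < 1 / (n : ℝ) := by positivity
  obtain ⟨K, hK, hyK, hKU⟩ := exists_compact_subset hU hy
  obtain ⟨r, hr, hrK⟩ := Metric.isOpen_iff.1 isOpen_interior y hyK
  let s : ℝ := min r (1 / (n : ℝ) / 3)
  have hs : 0 < s := lt_min hr (by positivity)
  have hsK : Metric.ball y s ⊆ K :=
    (Metric.ball_subset_ball (min_le_left _ _)).trans (hrK.trans interior_subset)
  have hne : q '' (Metric.ball y s)ᶜ ≠ Set.univ := by
    intro h
    have h2 := hirr _ Metric.isOpen_ball.isClosed_compl h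
    have h3 : y ∈ (Metric.ball y s)ᶜ := h2 ▸ Set.mem_univ y
    exact h3 (Metric.mem_ball_self hs)
  obtain ⟨x, hx⟩ := (Set.ne_univ_iff_exists_notMem _).1 hne
  have hsub : q ⁻¹' {x} ⊆ Metric.ball y s := by
    intro z hz
    by_contra hzb
    exact hx ⟨z, hzb, hz⟩
  refine ⟨x, hK.of_isClosed_subset (isClosed_singleton.preimage hqc) (hsub.trans hsK),
    (hsub.trans hsK).trans hKU, ?_⟩
  have h1 : Metric.diam (q ⁻¹' {x}) ≤ 2 * s :=
    (Metric.diam_mono hsub Metric.isBounded_ball).trans (Metric.diam_ball hs.le)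
  have h2 : s ≤ 1 / (n : ℝ) / 3 := min_le_right _ _
  linarith
end

section
/- Let Y be a locally compact, separable metric space and q : Y → X a continuous surjective map with X Hausdorff. Then the following are equivalent: (i) q is irreducible; (ii) for every nonempty open set U ⊆ Y and every n ∈ ℕ with n ≥ 1, there is a point x ∈ X such that the fibre q⁻¹(x) is compact, contained in U, and has diameter less than 1/n; (iii) the set of singleton fibres of q is dense in Y, and indeed contains a dense G_δ subset of Y. -/
open Filter Topology Set TopologicalSpace

universe u v w

theorem irred_imp_dense_gdelta {Y : Type u} {X : Type v} [MetricSpace Y] [LocallyCompactSpace Y]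
    [SeparableSpace Y] [TopologicalSpace X] [T2Space X]
    (q : Y → X) (hqc : Continuous q) (hqs : Function.Surjective q) (hq : IsIrreducibleMap q) :
    ∃ G : Set Y, G ⊆ {y : Y | SingletonFibre q y} ∧ IsGδ G ∧ Dense G := by
  haveI : SecondCountableTopology Y := UniformSpace.secondCountable_of_separable Y
  let B := countableBasis Y
  have hB : IsTopologicalBasis B := isBasis_countableBasis Y
  let S : Set (Set Y × Set Y) :=
    {p | p ∈ B ×ˢ B ∧ IsCompact (closure p.2) ∧ Disjoint (closure p.1) (closure p.2)}
  have hS : S.Countable :=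
    ((countable_countableBasis Y).prod (countable_countableBasis Y)).mono (fun p hp => hp.1)
  let F : Set Y × Set Y → Set Y := fun p => (closure p.1 ∩ q ⁻¹' (q '' closure p.2))ᶜ
  have hopen : ∀ p ∈ S, IsOpen (F p) := by
    rintro p ⟨-, hc, -⟩
    exact (isClosed_closure.inter ((hc.image hqc).isClosed.preimage hqc)).isOpen_compl
  have hdense : ∀ p ∈ S, Dense (F p) := by
    rintro p ⟨-, hc, hd⟩
    rw [← interior_eq_empty_iff_dense_compl]
    set A := closure p.1 ∩ q ⁻¹' (q '' closure p.2) with hA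
    have h1 : (interior A)ᶜ = Set.univ := by
      apply hq _ isOpen_interior.isClosed_compl
      rw [Set.eq_univ_iff_forall]
      intro x
      obtain ⟨y, rfl⟩ := hqs x
      by_cases hy : y ∈ interior A
      · obtain ⟨w, hw, hwy⟩ := (interior_subset hy).2
        refine ⟨w, fun hwA => ?_, hwy⟩
        exact Set.disjoint_left.1 hd (interior_subset hwA).1 hw
      · exact ⟨y, hy, rfl⟩
    exact Set.compl_univ_iff.1 h1
  refine ⟨⋂ p ∈ S, F p, ?_, IsGδ.biInter_of_isOpen hS hopen,
    dense_biInter_of_isOpen hopen hS hdense⟩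
  intro y hy
  show q ⁻¹' {q y} = {y}
  ext w
  constructor
  · intro hw
    by_contra hne
    have hne' : y ≠ w := fun h => hne h.symm
    obtain ⟨o₁, o₂, ho₁, ho₂, hy₁, hw₂, hd⟩ := t2_separation hne'
    obtain ⟨K, hK, hKw⟩ := exists_compact_mem_nhds w
    obtain ⟨U, hU, hyU, hUo⟩ := hB.exists_closure_subset (ho₁.mem_nhds hy₁)
    obtain ⟨V, hV, hwV, hVo⟩ :=
      hB.exists_closure_subset (Filter.inter_mem (ho₂.mem_nhds hw₂) hKw)
    have hp : (U, V) ∈ S :=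
      ⟨⟨hU, hV⟩, hK.of_isClosed_subset isClosed_closure (fun z hz => (hVo hz).2),
        hd.mono hUo (fun z hz => (hVo hz).1)⟩
    exact Set.mem_iInter₂.1 hy _ hp ⟨subset_closure hyU, w, subset_closure hwV, hw⟩
  · rintro rfl
    rfl

theorem statement_6 {Y : Type u} {X : Type v} [MetricSpace Y] [LocallyCompactSpace Y]
    [SeparableSpace Y] [TopologicalSpace X] [T2Space X]
    (q : Y → X) (hqc : Continuous q) (hqs : Function.Surjective q) :
    (IsIrreducibleMap q ↔
      (∀ U : Set Y, IsOpen U → U.Nonempty → ∀ n : ℕ, 1 ≤ n →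
        ∃ x : X, IsCompact (q ⁻¹' {x}) ∧ q ⁻¹' {x} ⊆ U ∧
          Metric.diam (q ⁻¹' {x}) < 1 / (n : ℝ))) ∧
    (IsIrreducibleMap q ↔
      (Dense {y : Y | SingletonFibre q y} ∧
        ∃ G : Set Y, G ⊆ {y : Y | SingletonFibre q y} ∧ IsGδ G ∧ Dense G)) := by
  have h12 : IsIrreducibleMap q → (Dense {y : Y | SingletonFibre q y} ∧
        ∃ G : Set Y, G ⊆ {y : Y | SingletonFibre q y} ∧ IsGδ G ∧ Dense G) := by
    intro hq
    obtain ⟨G, hG, hGd, hD⟩ := irred_imp_dense_gdelta q hqc hqs hq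
    exact ⟨hD.mono hG, G, hG, hGd, hD⟩
  have h23 : Dense {y : Y | SingletonFibre q y} →
      (∀ U : Set Y, IsOpen U → U.Nonempty → ∀ n : ℕ, 1 ≤ n →
        ∃ x : X, IsCompact (q ⁻¹' {x}) ∧ q ⁻¹' {x} ⊆ U ∧
          Metric.diam (q ⁻¹' {x}) < 1 / (n : ℝ)) := by
    intro hD U hU hne n hn
    obtain ⟨y, hyU, hy⟩ := hD.inter_open_nonempty U hU hne
    have hy' : q ⁻¹' {q y} = {y} := hy
    refine ⟨q y, ?_⟩
    rw [hy']
    refine ⟨isCompact_singleton, Set.singleton_subset_iff.2 hyU, ?_⟩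
    rw [Metric.diam_singleton]
    have : (0 : ℝ) < n := by exact_mod_cast hn
    positivity
  have h31 : (∀ U : Set Y, IsOpen U → U.Nonempty → ∀ n : ℕ, 1 ≤ n →
        ∃ x : X, IsCompact (q ⁻¹' {x}) ∧ q ⁻¹' {x} ⊆ U ∧
          Metric.diam (q ⁻¹' {x}) < 1 / (n : ℝ)) → IsIrreducibleMap q := by
    intro h V hV hqV
    by_contra hne
    obtain ⟨x, -, hx, -⟩ := h Vᶜ hV.isOpen_compl (Set.nonempty_compl.2 hne) 1 le_rfl
    obtain ⟨y, hy, hyx⟩ : x ∈ q '' V := hqV ▸ Set.mem_univ x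
    exact hx hyx hy
  exact ⟨⟨fun h => h23 (h12 h).1, h31⟩, ⟨h12, fun h => h31 (h23 h.1)⟩⟩
end

section
/- Let Y be a standard space and q : Y → X a quotient map with X Hausdorff. If q is irreducible, then q is a pure quotient map. -/
open Filter Topology Set TopologicalSpace

universe u v w

theorem statement_7 {Y : Type u} {X : Type v} [MetricSpace Y] [LocallyCompactSpace Y]
    [SeparableSpace Y] [TopologicalSpace X] [T2Space X]
    (q : Y → X) (hq : IsQuotMap q) (hirr : IsIrreducibleMap q) :
    IsPureQuotMap.{u, v, w} q := by
  obtain ⟨hsurj, hcont, hopen⟩ := id hq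
  have : SecondCountableTopology Y := UniformSpace.secondCountable_of_separable Y
  refine ⟨hq, {y | ∀ w, q w = q y → w = y}, ?_, ?_, ?_⟩
  · let S : Set (Set Y × Set Y) := {p | p ∈ countableBasis Y ×ˢ countableBasis Y ∧
      IsCompact (closure p.2) ∧ Disjoint (closure p.1) (closure p.2)}
    have hS : S.Countable :=
      ((countable_countableBasis Y).prod (countable_countableBasis Y)).mono fun p hp => hp.1
    have hB := isBasis_countableBasis Y
    have key : Dense (⋂ p ∈ S, (closure p.1 ∩ q ⁻¹' (q '' closure p.2))ᶜ) := by
      refine dense_biInter_of_isOpen ?_ hS ?_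
      · rintro p ⟨-, hc, -⟩
        exact (isClosed_closure.inter ((hc.image hcont).isClosed.preimage hcont)).isOpen_compl
      · rintro p ⟨-, hc, hd⟩
        rw [← interior_eq_empty_iff_dense_compl]
        have h := hirr (interior (closure p.1 ∩ q ⁻¹' (q '' closure p.2)))ᶜ
          isOpen_interior.isClosed_compl ?_
        · simpa using h
        · refine eq_univ_of_forall fun x => ?_
          obtain ⟨y, rfl⟩ := hsurj x
          by_cases hy : y ∈ interior (closure p.1 ∩ q ⁻¹' (q '' closure p.2))
          · obtain ⟨w, hw, hwy⟩ := (interior_subset hy).2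
            exact ⟨w, fun hw' => disjoint_left.1 hd (interior_subset hw').1 hw, hwy⟩
          · exact ⟨y, hy, rfl⟩
    refine key.mono fun y hy w hw => ?_
    by_contra hne
    obtain ⟨K, hK, hKy, hKc⟩ := local_compact_nhds (isOpen_compl_singleton.mem_nhds hne)
    obtain ⟨V, hV, hwV, hVK⟩ := hB.exists_closure_subset hK
    have hyV : (closure V)ᶜ ∈ 𝓝 y :=
      isClosed_closure.isOpen_compl.mem_nhds fun h => hKy (hVK h) rfl
    obtain ⟨U, hU, hyU, hUV⟩ := hB.exists_closure_subset hyV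
    have h1 := mem_iInter₂.1 hy (U, V) ⟨⟨hU, hV⟩, hKc.of_isClosed_subset isClosed_closure hVK,
      disjoint_left.2 hUV⟩
    exact h1 ⟨subset_closure hyU, w, subset_closure hwV, hw⟩
  · intro a _ b hb hab
    exact hb a hab
  · intro ι _ _ _ d e hd he ht
    have : e = d := funext fun i => hd i (e i) (he i).symm
    rwa [this]
end

section
/- Let Y be a first countable Hausdorff space and q : Y → X a quotient map with X Hausdorff. Let (x_n) be a sequence in X and x₀ ∈ X. Then the following are equivalent: (i) x_n → x₀; (ii) for every subsequence of (x_n) there exist a further subsequence (x_m) and points y_m ∈ q⁻¹(x_m) such that y_m → y for some y ∈ q⁻¹(x₀). -/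
open Filter Topology Set TopologicalSpace

universe u v w

theorem statement_8 {Y : Type u} {X : Type v} [TopologicalSpace Y]
    [FirstCountableTopology Y] [T2Space Y] [TopologicalSpace X] [T2Space X]
    (q : Y → X) (hq : IsQuotMap q) (x : ℕ → X) (x₀ : X) :
    Filter.Tendsto x Filter.atTop (nhds x₀) ↔
      ∀ φ : ℕ → ℕ, StrictMono φ →
        ∃ ψ : ℕ → ℕ, StrictMono ψ ∧
          ∃ (y : ℕ → Y) (y₀ : Y), y₀ ∈ q ⁻¹' {x₀} ∧
            (∀ m, y m ∈ q ⁻¹' {x (φ (ψ m))}) ∧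
            Filter.Tendsto y Filter.atTop (nhds y₀) := by
  obtain ⟨hsurj, hcont, hopen⟩ := hq
  constructor
  · intro hx φ hφ
    have hz : Tendsto (fun n => x (φ n)) atTop (𝓝 x₀) := hx.comp hφ.tendsto_atTop
    generalize hzd : (fun n => x (φ n)) = z at hz
    have hzn : ∀ n, x (φ n) = z n := fun n => congrFun hzd n
    have claim : ∃ y₀, q y₀ = x₀ ∧ ∀ U ∈ 𝓝 y₀, ∃ᶠ n in atTop, z n ∈ q '' U := by
      by_contra! hc
      have hne : ∀ᶠ n in atTop, z n ≠ x₀ := by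
        obtain ⟨y₀, hy₀⟩ := hsurj x₀
        obtain ⟨U, hU, h⟩ := hc y₀ hy₀
        have h' : ∀ᶠ n in atTop, z n ∉ q '' U := by simpa [Filter.Frequently] using h
        filter_upwards [h'] with n hn he
        exact hn ⟨y₀, mem_of_mem_nhds hU, by rw [hy₀, he]⟩
      obtain ⟨N₀, hN₀⟩ := eventually_atTop.1 hne
      have hcl : IsClosed (insert x₀ (range fun n => z (n + N₀))) :=
        (((tendsto_add_atTop_iff_nat N₀).2 hz).isCompact_insert_range).isClosed
      have hA : IsOpen (range fun n => z (n + N₀))ᶜ := by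
        rw [hopen, isOpen_iff_mem_nhds]
        intro y hy
        by_cases hyx : q y = x₀
        · obtain ⟨U, hU, h⟩ := hc y hyx
          have h' : ∀ᶠ n in atTop, z n ∉ q '' U := by simpa [Filter.Frequently] using h
          obtain ⟨N, hN⟩ := eventually_atTop.1 h'
          have hfin : ∀ᶠ w in 𝓝 y, ∀ n ∈ Finset.range N, N₀ ≤ n → q w ≠ z n := by
            rw [Filter.eventually_all_finset]
            intro n _
            by_cases hn : N₀ ≤ n
            · have : q y ≠ z n := by rw [hyx]; exact (hN₀ n hn).symm
              filter_upwards [hcont.continuousAt.eventually_ne this] with w hw _ using hw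
            · exact Eventually.of_forall fun w h => absurd h hn
          filter_upwards [hU, hfin] with w hwU hw
          rintro ⟨n, hn⟩
          by_cases hnN : N ≤ n + N₀
          · exact hN _ hnN ⟨w, hwU, hn.symm⟩
          · exact hw (n + N₀) (Finset.mem_range.2 (by omega)) (by omega) hn.symm
        · have h1 : q y ∈ (insert x₀ (range fun n => z (n + N₀)))ᶜ := by
            rintro (h | h)
            · exact hyx h
            · exact hy h
          filter_upwards [hcont.continuousAt.preimage_mem_nhds (hcl.isOpen_compl.mem_nhds h1)]
            with w hw h
          exact hw (Or.inr h)
      have hx0 : x₀ ∈ (range fun n => z (n + N₀))ᶜ := by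
        rintro ⟨n, hn⟩
        exact hN₀ _ (by omega) hn
      obtain ⟨n, hn⟩ :=
        (((tendsto_add_atTop_iff_nat N₀).2 hz).eventually (hA.mem_nhds hx0)).exists
      exact hn ⟨n, rfl⟩
    obtain ⟨y₀, hy₀, h⟩ := claim
    obtain ⟨U, hU⟩ := (𝓝 y₀).exists_antitone_basis
    obtain ⟨ψ, hψ, hψU⟩ := extraction_forall_of_frequently
      (fun k => h (U k) (hU.mem k))
    choose y hyU hyq using hψU
    refine ⟨ψ, hψ, y, y₀, hy₀, fun m => ?_, hU.tendsto hyU⟩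
    simp [hyq, hzn]
  · intro h
    refine tendsto_of_subseq_tendsto fun ns hns => ?_
    obtain ⟨θ, hθ, hθm⟩ := strictMono_subseq_of_tendsto_atTop hns
    obtain ⟨ψ, hψ, y, y₀, hy₀, hy, hlim⟩ := h _ hθm
    refine ⟨fun n => θ (ψ n), ?_⟩
    have h2 := (hcont.tendsto y₀).comp hlim
    rw [show q y₀ = x₀ from hy₀] at h2
    refine h2.congr fun n => ?_
    exact hy n
end

section
/- Let Y be a standard space and q : Y → X a quotient map with X Hausdorff. Let V be the closure in Y of the set of singleton fibres of q and set p = q restricted to V. Then the following are equivalent: (i) p maps V surjectively onto X (in which case p is moreover an irreducible map from V onto X); (ii) the image under q of the set of singleton fibres of q is sequentially dense in X. -/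
open Filter Topology Set TopologicalSpace

universe u v w

theorem statement_9 {Y : Type u} {X : Type v} [MetricSpace Y] [LocallyCompactSpace Y]
    [SeparableSpace Y] [TopologicalSpace X] [T2Space X]
    (q : Y → X) (hq : IsQuotMap q)
    (V : Set Y) (hV : V = closure {y : Y | SingletonFibre q y}) :
    (Function.Surjective (V.restrict q) ↔
      SeqDense (q '' {y : Y | SingletonFibre q y})) ∧
    (Function.Surjective (V.restrict q) → IsIrreducibleMap (V.restrict q)) := by
  obtain ⟨_, hc, ho⟩ := hq
  have hSV : {y : Y | SingletonFibre q y} ⊆ V := hV ▸ subset_closure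
  have hVc : IsClosed V := hV ▸ isClosed_closure
  have hsing : ∀ y z : Y, SingletonFibre q y → q z = q y → z = y := by
    intro y z hy hz
    have h : z ∈ q ⁻¹' {q y} := hz
    rw [hy] at h
    exact h
  refine ⟨⟨?_, ?_⟩, ?_⟩
  · intro hs x
    obtain ⟨⟨v, hv⟩, rfl⟩ := hs x
    have hv' := hv
    rw [hV, mem_closure_iff_seq_limit] at hv'
    obtain ⟨s, hs1, hs2⟩ := hv'
    exact ⟨fun n => q (s n), fun n => ⟨s n, hs1 n, rfl⟩, (hc.tendsto v).comp hs2⟩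
  · intro hs x
    obtain ⟨t, ht, hlim⟩ := hs x
    choose y hy hyt using ht
    by_contra hx
    have hxV : ∀ z ∈ V, q z ≠ x := fun z hz h => hx ⟨⟨z, hz⟩, h⟩
    have hK : IsClosed (insert x (range t)) := hlim.isCompact_insert_range.isClosed
    have hpre : q ⁻¹' (range t) = V ∩ q ⁻¹' (insert x (range t)) := by
      ext z
      constructor
      · rintro ⟨n, hn⟩
        refine ⟨?_, Or.inr ⟨n, hn⟩⟩
        have : z = y n := hsing _ _ (hy n) (by rw [hyt, hn])
        rw [this]
        exact hSV (hy n)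
      · rintro ⟨hz, h | h⟩
        · exact absurd h (hxV z hz)
        · exact h
    have hcl : IsClosed (range t) := by
      rw [← isOpen_compl_iff, ho, preimage_compl, isOpen_compl_iff, hpre]
      exact hVc.inter (hK.preimage hc)
    obtain ⟨n, hn⟩ := hcl.mem_of_tendsto hlim (Eventually.of_forall fun n => mem_range_self n)
    exact hxV (y n) (hSV (hy n)) (by rw [hyt, hn])
  · intro _ W hW himg
    have hW' : IsClosed (Subtype.val '' W : Set Y) := hVc.isClosedEmbedding_subtypeVal.isClosedMap _ hW
    have hsub : V ⊆ Subtype.val '' W := by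
      conv_lhs => rw [hV]
      refine closure_minimal ?_ hW'
      intro y hy
      have : q y ∈ V.restrict q '' W := by rw [himg]; trivial
      obtain ⟨w, hw, hwy⟩ := this
      exact ⟨w, hw, hsing y w hy hwy⟩
    refine eq_univ_of_forall fun v => ?_
    obtain ⟨w, hw, hwv⟩ := hsub v.2
    exact Subtype.ext hwv ▸ hw
end

section
/- Let Y be a locally compact Hausdorff space and q : Y → X a quotient map with X Hausdorff. If every fibre q⁻¹(x) (x ∈ X) is compact, then every full subset of Y contains a minimal full subset. -/
open Filter Topology Set TopologicalSpace

universe u v w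

theorem statement_10 {Y : Type u} {X : Type v} [TopologicalSpace Y] [T2Space Y]
    [LocallyCompactSpace Y] [TopologicalSpace X] [T2Space X]
    (q : Y → X) (hq : IsQuotMap q) (hfib : ∀ x : X, IsCompact (q ⁻¹' {x})) :
    ∀ W : Set Y, IsFull q W → ∃ Z : Set Y, Z ⊆ W ∧ IsMinFull q Z := by
  intro W hW
  obtain ⟨Z, hZW, hZ⟩ := zorn_superset_nonempty {V : Set Y | IsFull q V} (by
    intro c hc hchain hne
    refine ⟨⋂₀ c, ⟨isClosed_sInter fun s hs => (hc hs).1, ?_⟩, fun s hs => sInter_subset_of_mem hs⟩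
    rw [eq_univ_iff_forall]
    intro x
    haveI : Nonempty c := hne.to_subtype
    have hcl : IsClosed (q ⁻¹' {x}) := isClosed_singleton.preimage hq.2.1
    obtain ⟨y, hy⟩ := IsCompact.nonempty_iInter_of_directed_nonempty_isCompact_isClosed
      (fun s : c => (s : Set Y) ∩ q ⁻¹' {x})
      (by
        intro a b
        rcases hchain.total a.2 b.2 with h | h
        · exact ⟨a, subset_rfl, inter_subset_inter_left _ h⟩
        · exact ⟨b, inter_subset_inter_left _ h, subset_rfl⟩)
      (fun s => by
        have hx : x ∈ q '' (s : Set Y) := by rw [(hc s.2).2]; trivial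
        obtain ⟨y, hy, hyx⟩ := hx
        exact ⟨y, hy, hyx⟩)
      (fun s => (hfib x).inter_left (hc s.2).1)
      (fun s => (hc s.2).1.inter hcl)
    rw [mem_iInter] at hy
    exact ⟨y, fun s hs => (hy ⟨s, hs⟩).1, (hy (Classical.arbitrary c)).2⟩) W hW
  exact ⟨Z, hZW, hZ.prop, fun V hVZ hV => subset_antisymm hVZ (hZ.le_of_le hV hVZ)⟩
end

section
/- Let Y be a locally compact Hausdorff space and q : Y → X a closed quotient map with X Hausdorff. If the set {x ∈ X : q⁻¹(x) is compact} is dense in X, then every full subset of Y contains a minimal full subset. -/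
open Filter Topology Set TopologicalSpace

universe u v w

theorem statement_11 {Y : Type u} {X : Type v} [TopologicalSpace Y] [T2Space Y]
    [LocallyCompactSpace Y] [TopologicalSpace X] [T2Space X]
    (q : Y → X) (hq : IsQuotMap q) (hqc : IsClosedMap q)
    (hdense : Dense {x : X | IsCompact (q ⁻¹' {x})}) :
    ∀ W : Set Y, IsFull q W → ∃ Z : Set Y, Z ⊆ W ∧ IsMinFull q Z := by
  intro W hW
  obtain ⟨Z, hZW, hZ⟩ := zorn_superset_nonempty {A : Set Y | IsFull q A} (by
    intro c hc hch hne
    refine ⟨⋂₀ c, ⟨isClosed_sInter fun t ht => (hc ht).1, ?_⟩, fun s hs => sInter_subset_of_mem hs⟩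
    have hcl : IsClosed (⋂₀ c) := isClosed_sInter fun t ht => (hc ht).1
    have hd : Dense (q '' ⋂₀ c) := by
      refine hdense.mono ?_
      intro x hx
      have hx' : IsCompact (q ⁻¹' {x}) := hx
      have hfc : IsClosed (q ⁻¹' {x}) := hx'.isClosed
      haveI : Nonempty c := hne.to_subtype
      have key := IsCompact.nonempty_iInter_of_directed_nonempty_isCompact_isClosed
        (fun t : c => (t : Set Y) ∩ q ⁻¹' {x}) (by
          intro s t
          rcases hch.total s.2 t.2 with h | h
          · exact ⟨s, subset_rfl, inter_subset_inter_left _ h⟩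
          · exact ⟨t, inter_subset_inter_left _ h, subset_rfl⟩)
        (by
          intro t
          have hxt : x ∈ q '' (t : Set Y) := by rw [(hc t.2).2]; trivial
          obtain ⟨y, hy, hyx⟩ := hxt
          exact ⟨y, hy, hyx⟩)
        (fun t => hx'.inter_left (hc t.2).1)
        (fun t => (hc t.2).1.inter hfc)
      obtain ⟨y, hy⟩ := key
      rw [mem_iInter] at hy
      exact ⟨y, fun t ht => (hy ⟨t, ht⟩).1, (hy (Classical.arbitrary c)).2⟩
    rw [← (hqc _ hcl).closure_eq, hd.closure_eq]) W hW
  exact ⟨Z, hZW, hZ.prop, fun V hV hVf => subset_antisymm hV (hZ.le_of_le hVf hV)⟩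
end

section
/- Let Y be a standard space, q : Y → X a quotient map with X Hausdorff, and V a minimal full subset of Y. Suppose U is a nonempty relatively open subset of V whose closure L (in Y) is compact, and K is a compact subset of Y disjoint from V such that q(K) = q(L). Then V is not the unique minimal full subset of Y; that is, there exists a minimal full subset Z of Y with Z ≠ V. -/
open Filter Topology Set TopologicalSpace

universe u v w

theorem statement_12 {Y : Type u} {X : Type v} [MetricSpace Y] [LocallyCompactSpace Y]
    [SeparableSpace Y] [TopologicalSpace X] [T2Space X]
    (q : Y → X) (hq : IsQuotMap q) (V : Set Y) (hV : IsMinFull q V)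
    (U : Set Y) (hUne : U.Nonempty) (hUopen : ∃ O : Set Y, IsOpen O ∧ U = O ∩ V)
    (hL : IsCompact (closure U))
    (K : Set Y) (hK : IsCompact K) (hKV : Disjoint K V)
    (hqK : q '' K = q '' (closure U)) :
    ∃ Z : Set Y, IsMinFull q Z ∧ Z ≠ V := by
  obtain ⟨O, hO, rfl⟩ := hUopen
  obtain ⟨hqs, hqc, -⟩ := hq
  obtain ⟨⟨hVc, hVf⟩, hVmin⟩ := hV
  set L := closure (O ∩ V) with hLdef
  have hUL : O ∩ V ⊆ L := subset_closure
  have hLV : L ⊆ V := closure_minimal inter_subset_right hVc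
  have hWc : IsClosed ((V \ O) ∪ K) := (hVc.sdiff hO).union hK.isClosed
  have hWf : IsFull q ((V \ O) ∪ K) := by
    refine ⟨hWc, eq_univ_of_forall fun x => ?_⟩
    have hx : x ∈ q '' V := hVf ▸ mem_univ x
    obtain ⟨y, hy, rfl⟩ := hx
    by_cases hyO : y ∈ O
    · have : q y ∈ q '' K := hqK ▸ mem_image_of_mem q (hUL ⟨hyO, hy⟩)
      exact image_mono subset_union_right this
    · exact ⟨y, Or.inl ⟨hy, hyO⟩, rfl⟩
  -- every full subset of W contains V \ L
  have key : ∀ C ⊆ (V \ O) ∪ K, IsFull q C → V \ L ⊆ C := by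
    intro C hCW hC y hy
    have h1 : (C ∩ V) ∪ L = V := by
      refine hVmin _ (union_subset inter_subset_right hLV)
        ⟨(hC.1.inter hVc).union isClosed_closure, eq_univ_of_forall fun x => ?_⟩
      have hx : x ∈ q '' C := hC.2 ▸ mem_univ x
      obtain ⟨z, hz, rfl⟩ := hx
      rcases hCW hz with h | h
      · exact ⟨z, Or.inl ⟨hz, h.1⟩, rfl⟩
      · have : q z ∈ q '' L := hqK ▸ mem_image_of_mem q h
        exact image_mono subset_union_right this
    have h2 : y ∈ (C ∩ V) ∪ L := h1.symm ▸ hy.1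
    rcases h2 with h | h
    · exact h.1
    · exact absurd h hy.2
  obtain ⟨Z, -, hZ⟩ := zorn_superset_nonempty {C | C ⊆ (V \ O) ∪ K ∧ IsFull q C} (by
    intro c hcS hch hne
    refine ⟨⋂₀ c, ⟨?_, isClosed_sInter fun C hC => (hcS hC).2.1, ?_⟩,
      fun s hs => sInter_subset_of_mem hs⟩
    · obtain ⟨C, hC⟩ := hne
      exact (sInter_subset_of_mem hC).trans (hcS hC).1
    refine eq_univ_of_forall fun x => ?_
    by_cases hx : x ∈ q '' (V \ L)
    · obtain ⟨y, hy, rfl⟩ := hx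
      exact ⟨y, fun C hC => key C (hcS hC).1 (hcS hC).2 hy, rfl⟩
    have hT : IsCompact ((L ∪ K) ∩ q ⁻¹' {x}) :=
      (hL.union hK).inter_right (isClosed_singleton.preimage hqc)
    have : Nonempty c := hne.to_subtype
    have hn := IsCompact.nonempty_iInter_of_directed_nonempty_isCompact_isClosed
      (fun C : c => (C : Set Y) ∩ ((L ∪ K) ∩ q ⁻¹' {x})) (by
        intro A B
        rcases hch.total A.2 B.2 with h | h
        · exact ⟨A, Subset.rfl, inter_subset_inter_left _ h⟩
        · exact ⟨B, inter_subset_inter_left _ h, Subset.rfl⟩)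
      (by
        intro C
        have hxC : x ∈ q '' (C : Set Y) := (hcS C.2).2.2 ▸ mem_univ x
        obtain ⟨z, hz, hzx⟩ := hxC
        refine ⟨z, hz, ?_, hzx⟩
        rcases (hcS C.2).1 hz with h | h
        · left
          by_contra hzL
          exact hx ⟨z, ⟨h.1, hzL⟩, hzx⟩
        · exact Or.inr h)
      (fun C => hT.inter_left (hcS C.2).2.1)
      (fun C => (hcS C.2).2.1.inter hT.isClosed)
    obtain ⟨z, hz⟩ := hn
    rw [mem_iInter] at hz
    obtain ⟨C, hC⟩ := hne
    exact ⟨z, fun D hD => (hz ⟨D, hD⟩).1, (hz ⟨C, hC⟩).2.2⟩) _ ⟨Subset.rfl, hWf⟩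
  refine ⟨Z, ⟨hZ.prop.2, fun D hD hDf => ?_⟩, ?_⟩
  · exact Subset.antisymm hD (hZ.le_of_le ⟨hD.trans hZ.prop.1, hDf⟩ hD)
  · rintro rfl
    obtain ⟨y, hyO, hyV⟩ := hUne
    rcases hZ.prop.1 hyV with h | h
    · exact h.2 hyO
    · exact disjoint_left.1 hKV h hyV
end

section
/- Let Y be a standard space, q : Y → X a quotient map with X Hausdorff, and V a minimal full subset of Y. Then V is the unique minimal full subset of Y if and only if V equals the closure in Y of the set of singleton fibres of q. -/
open Filter Topology Set TopologicalSpace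

universe u v w

theorem aux_baire {Y : Type u} {X : Type v} [MetricSpace Y] [LocallyCompactSpace Y]
    [SeparableSpace Y] [TopologicalSpace X] [T2Space X]
    (q : Y → X) (hq : Continuous q) (V R : Set Y) (hV : IsClosed V) (hR : IsClosed R)
    (H : ∀ O C : Set Y, IsOpen O → (O ∩ V).Nonempty → IsCompact C → C ⊆ R → Disjoint C O →
      ¬ (O ∩ V ⊆ q ⁻¹' (q '' C))) :
    V ⊆ closure {y | y ∈ V ∧ ∀ z ∈ R, q z = q y → z = y} := by
  haveI : SecondCountableTopology Y := UniformSpace.secondCountable_of_separable Y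
  haveI : LocallyCompactSpace V := hV.isClosedEmbedding_subtypeVal.locallyCompactSpace
  have hb := isBasis_countableBasis Y
  haveI : Countable (countableBasis Y) := (countable_countableBasis Y).to_subtype
  let K : countableBasis Y × ℕ → Set Y := fun i => (compactCovering Y i.2 ∩ R) \ i.1.1
  have hK : ∀ i, IsCompact (K i) := fun i =>
    ((isCompact_compactCovering Y i.2).inter_right hR).diff (hb.isOpen i.1.2)
  let D : countableBasis Y × ℕ → Set V := fun i =>
    Subtype.val ⁻¹' (i.1.1)ᶜ ∪ Subtype.val ⁻¹' (q ⁻¹' (q '' K i))ᶜ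
  have hD : Dense (⋂ i, D i) := by
    apply dense_iInter_of_Gδ
    · intro i
      apply IsGδ.union
      · exact ((hb.isOpen i.1.2).isClosed_compl.preimage continuous_subtype_val).isGδ
      · exact ((((hK i).image hq).isClosed.preimage hq).isOpen_compl.preimage
          continuous_subtype_val).isGδ
    · intro i
      rw [dense_iff_inter_open]
      rintro U hU ⟨u, hu⟩
      obtain ⟨O, hO, rfl⟩ := isOpen_induced_iff.1 hU
      by_contra hne
      have hsub : ∀ y : V, y.1 ∈ O → y.1 ∈ i.1.1 ∧ q y.1 ∈ q '' K i := by
        intro y hy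
        by_contra hcon
        apply hne
        refine ⟨y, hy, ?_⟩
        by_cases h1 : y.1 ∈ i.1.1
        · exact Or.inr fun h2 => hcon ⟨h1, h2⟩
        · exact Or.inl h1
      refine H (O ∩ i.1.1) (K i) (hO.inter (hb.isOpen i.1.2)) ⟨u.1, ⟨hu, (hsub u hu).1⟩, u.2⟩
        (hK i) (fun y hy => hy.1.2) ?_ ?_
      · exact Set.disjoint_left.2 fun y hy h => hy.2 h.2
      · rintro y ⟨⟨h1, h2⟩, h3⟩
        exact (hsub ⟨y, h3⟩ h1).2
  intro v hv
  rw [mem_closure_iff]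
  intro O hO hvO
  obtain ⟨y, hyO, hyD⟩ := hD.inter_open_nonempty _ (hO.preimage continuous_subtype_val)
    ⟨⟨v, hv⟩, hvO⟩
  refine ⟨y.1, hyO, y.2, ?_⟩
  intro z hz hqz
  by_contra hne
  obtain ⟨B, hB, hyB, hBz⟩ := hb.mem_nhds_iff.1
    (isOpen_compl_singleton.mem_nhds (show y.1 ∈ ({z} : Set Y)ᶜ from fun h => hne h.symm))
  obtain ⟨n, hn⟩ := exists_mem_compactCovering z
  have h := Set.mem_iInter.1 hyD (⟨B, hB⟩, n)
  rcases h with h | h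
  · exact h hyB
  · exact h ⟨z, ⟨⟨hn, hz⟩, fun hzB => hBz hzB rfl⟩, hqz⟩

theorem aux_min {Y : Type u} {X : Type v} [MetricSpace Y] [TopologicalSpace X] [T2Space X]
    (q : Y → X) (hq : Continuous q) (E C : Set Y) (hE : IsClosed E) (hC : IsCompact C)
    (hf : IsFull q (E ∪ C)) (hEm : ∀ Z ⊆ E ∪ C, IsFull q Z → E ⊆ Z) :
    ∃ W ⊆ E ∪ C, IsMinFull q W := by
  obtain ⟨M, hM⟩ := zorn_superset {D : Set Y | IsClosed D ∧ D ⊆ C ∧ q '' (E ∪ D) = univ} (by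
    intro c hc hchain
    rcases c.eq_empty_or_nonempty with rfl | hne
    · exact ⟨C, ⟨hC.isClosed, subset_rfl, hf.2⟩, by simp⟩
    refine ⟨⋂₀ c, ⟨isClosed_sInter fun s hs => (hc hs).1, ?_, ?_⟩,
      fun s hs => sInter_subset_of_mem hs⟩
    · obtain ⟨s, hs⟩ := hne
      exact (sInter_subset_of_mem hs).trans (hc hs).2.1
    · rw [eq_univ_iff_forall]
      intro x
      by_cases hx : x ∈ q '' E
      · exact image_mono subset_union_left hx
      haveI : Nonempty c := hne.to_subtype
      have hcl : IsClosed (q ⁻¹' {x}) := isClosed_singleton.preimage hq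
      have := IsCompact.nonempty_iInter_of_directed_nonempty_isCompact_isClosed
        (fun s : c => s.1 ∩ q ⁻¹' {x}) (by
          intro s t
          rcases hchain.total s.2 t.2 with h | h
          · exact ⟨s, subset_rfl, inter_subset_inter_left _ h⟩
          · exact ⟨t, inter_subset_inter_left _ h, subset_rfl⟩) (by
          intro s
          have hx' : x ∈ q '' (E ∪ s.1) := by rw [(hc s.2).2.2]; trivial
          obtain ⟨y, hy | hy, rfl⟩ := hx'
          · exact absurd ⟨y, hy, rfl⟩ hx
          · exact ⟨y, hy, rfl⟩) (fun s =>
          (hC.of_isClosed_subset (hc s.2).1 (hc s.2).2.1).inter_right hcl)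
          (fun s => (hc s.2).1.inter hcl)
      obtain ⟨y, hy⟩ := this
      rw [mem_iInter] at hy
      refine ⟨y, Or.inr ?_, (hy ⟨_, hne.some_mem⟩).2⟩
      exact fun s hs => (hy ⟨s, hs⟩).1)
  have hMC := hM.prop.2.1
  refine ⟨E ∪ M, union_subset_union_right _ hMC, ⟨hE.union hM.prop.1, hM.prop.2.2⟩, ?_⟩
  intro Z hZ hZf
  have hEZ := hEm Z (hZ.trans (union_subset_union_right _ hMC)) hZf
  have hZeq : E ∪ (Z ∩ M) = Z := by
    apply subset_antisymm
    · exact union_subset hEZ inter_subset_left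
    · intro z hz
      rcases hZ hz with h | h
      · exact Or.inl h
      · exact Or.inr ⟨hz, h⟩
  have := hM.le_of_le (y := Z ∩ M)
    ⟨hZf.1.inter hM.prop.1, inter_subset_right.trans hMC, by rw [hZeq]; exact hZf.2⟩
    inter_subset_right
  exact subset_antisymm hZ (union_subset hEZ fun m hm => (this hm).1)

theorem statement_13 {Y : Type u} {X : Type v} [MetricSpace Y] [LocallyCompactSpace Y]
    [SeparableSpace Y] [TopologicalSpace X] [T2Space X]
    (q : Y → X) (hq : IsQuotMap q) (V : Set Y) (hV : IsMinFull q V) :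
    (∀ W : Set Y, IsMinFull q W → W = V) ↔
      V = closure {y : Y | SingletonFibre q y} := by
  obtain ⟨-, hqc, -⟩ := hq
  obtain ⟨⟨hVc, hVf⟩, hVm⟩ := hV
  have hS : ∀ W, IsFull q W → closure {y : Y | SingletonFibre q y} ⊆ W := by
    intro W hW
    apply closure_minimal _ hW.1
    intro y hy
    have : q y ∈ q '' W := by rw [hW.2]; trivial
    obtain ⟨w, hw, hwy⟩ := this
    have : w ∈ q ⁻¹' {q y} := hwy
    rw [show q ⁻¹' {q y} = {y} from hy] at this
    rwa [← show w = y from this]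
  constructor
  swap
  · intro h W hW
    have : V ⊆ W := h ▸ hS W hW.1
    exact (hW.2 V this ⟨hVc, hVf⟩).symm
  intro huniq
  refine subset_antisymm ?_ (hS V ⟨hVc, hVf⟩)
  have hT := aux_baire q hqc V V hVc hVc (by
    intro O C hO hne hC hCV hdis hsub
    have hZ : IsFull q (V \ O) := by
      refine ⟨hVc.sdiff hO, eq_univ_iff_forall.2 fun x => ?_⟩
      have : x ∈ q '' V := by rw [hVf]; trivial
      obtain ⟨v, hv, rfl⟩ := this
      by_cases hvO : v ∈ O
      · obtain ⟨c, hc, hcv⟩ := hsub ⟨hvO, hv⟩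
        exact ⟨c, ⟨hCV hc, Set.disjoint_left.1 hdis hc⟩, hcv⟩
      · exact ⟨v, ⟨hv, hvO⟩, rfl⟩
    have := hVm _ diff_subset hZ
    obtain ⟨v, hvO, hv⟩ := hne
    rw [← this] at hv
    exact hv.2 hvO)
  set T := {y | y ∈ V ∧ ∀ z ∈ V, q z = q y → z = y} with hTdef
  refine (aux_baire q hqc V univ hVc isClosed_univ ?_).trans (closure_mono ?_)
  swap
  · rintro y ⟨-, hy⟩
    refine subset_antisymm (fun z hz => hy z trivial hz) ?_
    rintro z rfl
    rfl
  intro O C hO hne hC _ hdis hsub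
  have hF : IsClosed (q ⁻¹' (q '' C)) := (hC.image hqc).isClosed.preimage hqc
  set F := q ⁻¹' (q '' C) with hFdef
  have hEV : closure (T \ F) ⊆ V := closure_minimal (fun y hy => hy.1.1) hVc
  have hVE : V \ F ⊆ closure (T \ F) := by
    rintro v ⟨hv, hvF⟩
    rw [mem_closure_iff]
    intro U hU hvU
    obtain ⟨y, ⟨hyU, hyF⟩, hyT⟩ := mem_closure_iff.1 (hT hv) (U ∩ Fᶜ)
      (hU.inter hF.isOpen_compl) ⟨hvU, hvF⟩
    exact ⟨y, hyU, hyT, hyF⟩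
  obtain ⟨W, hWs, hW⟩ := aux_min q hqc (closure (T \ F)) C isClosed_closure hC (by
    refine ⟨isClosed_closure.union hC.isClosed, eq_univ_iff_forall.2 fun x => ?_⟩
    have : x ∈ q '' V := by rw [hVf]; trivial
    obtain ⟨v, hv, rfl⟩ := this
    by_cases hvF : v ∈ F
    · exact image_mono subset_union_right hvF
    · exact ⟨v, Or.inl (hVE ⟨hv, hvF⟩), rfl⟩) (by
    intro Z hZ hZf
    apply closure_minimal _ hZf.1
    rintro d ⟨hdT, hdF⟩
    have : q d ∈ q '' Z := by rw [hZf.2]; trivial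
    obtain ⟨z, hz, hzd⟩ := this
    rcases hZ hz with h | h
    · rwa [← hdT.2 z (hEV h) hzd]
    · exact absurd ⟨z, h, hzd⟩ hdF)
  obtain ⟨v, hvO, hv⟩ := hne
  rw [← huniq W hW] at hv
  rcases hWs hv with h | h
  · obtain ⟨y, hyO, hyT, hyF⟩ := mem_closure_iff.1 h O hO hvO
    exact hyF (hsub ⟨hyO, hyT.1⟩)
  · exact Set.disjoint_left.1 hdis h hvO
end

section
/- Let q : Y → X be a pure quotient map from a standard space Y to a Hausdorff space X, and let x ∈ X. Then x is of compact type if and only if q⁻¹(x) is compact. -/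
open Filter Topology Set TopologicalSpace

universe u v w

theorem statement_14 {Y : Type u} {X : Type v} [MetricSpace Y] [LocallyCompactSpace Y]
    [SeparableSpace Y] [TopologicalSpace X] [T2Space X]
    (q : Y → X) (hq : IsPureQuotMap.{u, v, w} q) (x : X) :
    CompactType x ↔ IsCompact (q ⁻¹' {x}) := by
  obtain ⟨⟨hsurj, hcont, hopen⟩, D, hD, -, hpure⟩ := hq
  have hqm : IsQuotientMap q := by
    refine (isQuotientMap_iff q).2 ⟨⟨?_⟩, hsurj⟩
    ext s
    exact (hopen s).trans isOpen_coinduced.symm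
  have : SecondCountableTopology Y := UniformSpace.secondCountable_of_separable Y
  have hfib : ∀ z : X, IsClosed (q ⁻¹' {z}) := fun z => isClosed_singleton.preimage hcont
  constructor
  · rintro ⟨K, hK, hKu⟩
    by_contra hnc
    have hnhds : ∀ y, q y = x → q ⁻¹' K ∈ 𝓝 y := by
      intro y hy
      by_contra hn
      have hcl : y ∈ closure (q ⁻¹' K)ᶜ := by
        rw [closure_compl]
        exact fun h => hn (mem_interior_iff_mem_nhds.1 h)
      obtain ⟨u, hu, hlim⟩ := mem_closure_iff_seq_limit.1 hcl
      have h1 : Tendsto (fun n => q (u n)) atTop (𝓝 x) := by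
        rw [← hy]
        exact (hcont.tendsto y).comp hlim
      obtain ⟨n, hn'⟩ := (hKu _ h1).exists
      exact hu n hn'
    let E : CompactExhaustion Y := default
    have hd : ∀ n, ∃ d ∈ D, q d ∈ K ∧ d ∉ E n := by
      intro n
      have h1 : ∃ y, q y = x ∧ y ∉ E n := by
        by_contra! h
        exact hnc ((E.isCompact n).of_isClosed_subset (hfib x) (fun y hy => h y hy))
      obtain ⟨y, hy, hyE⟩ := h1
      have h2 : q ⁻¹' K ∩ (E n)ᶜ ∈ 𝓝 y :=
        inter_mem (hnhds y hy) ((E.isCompact n).isClosed.isOpen_compl.mem_nhds hyE)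
      obtain ⟨d, hdD, hd⟩ := hD.inter_nhds_nonempty h2
      exact ⟨d, hdD, hd.1, hd.2⟩
    choose d hdD hdK hdE using hd
    have hdt : Tendsto d atTop (cocompact Y) := by
      refine (hasBasis_cocompact.tendsto_right_iff).2 ?_
      intro C hC
      obtain ⟨n, hn⟩ := E.exists_superset_of_isCompact hC
      filter_upwards [eventually_ge_atTop n] with m hm hmC
      exact hdE m (E.subset hm (hn hmC))
    have key : ∀ C : Set Y, IsCompact C → ∀ᶠ m in atTop, ∀ e ∈ C, q (d m) ≠ q e := by
      intro C hC
      classical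
      have hex : ∀ m, ∃ e, q (d m) = q e ∧ ((∃ e' ∈ C, q (d m) = q e') → e ∈ C) := by
        intro m
        by_cases h : ∃ e' ∈ C, q (d m) = q e'
        · obtain ⟨e', h1, h2⟩ := h
          exact ⟨e', h2, fun _ => h1⟩
        · exact ⟨d m, rfl, fun h' => absurd h' h⟩
      choose e he heC using hex
      have hup : Tendsto (ULift.up.{w} : ℕ → ULift.{w} ℕ) atTop atTop :=
        tendsto_atTop_atTop.2 fun b => ⟨b.down, fun a ha => ha⟩
      have hdown : Tendsto (ULift.down : ULift.{w} ℕ → ℕ) atTop atTop :=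
        tendsto_atTop_atTop.2 fun b => ⟨⟨b⟩, fun a ha => ha⟩
      have ht := hpure (ULift.{w} ℕ) inferInstance inferInstance inferInstance
        (fun i => d i.down) (fun i => e i.down) (fun i => hdD _) (fun i => he _)
        (hdt.comp hdown)
      have ht' : Tendsto e atTop (cocompact Y) := ht.comp hup
      filter_upwards [ht'.eventually hC.compl_mem_cocompact] with m hm e' he' hqe
      exact hm (heC m ⟨e', he', hqe⟩)
    have hlf : LocallyFinite (fun m => q ⁻¹' {q (d m)}) := by
      intro y
      obtain ⟨C, hC, hCy⟩ := exists_compact_mem_nhds y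
      refine ⟨C, hCy, ?_⟩
      obtain ⟨N, hN⟩ := eventually_atTop.1 (key C hC)
      refine (finite_lt_nat N).subset ?_
      rintro m ⟨e, he, heC⟩
      by_contra hm
      exact hN m (not_lt.1 hm) e heC he.symm
    have hclosed : ∀ n, IsClosed (range fun m => q (d (m + n))) := by
      intro n
      rw [← hqm.isClosed_preimage]
      have h := (hlf.comp_injective (add_left_injective n)).isClosed_iUnion
        (fun m => hfib _)
      convert h using 1
      ext y
      simp [eq_comm]
    obtain ⟨z, -, hz⟩ := hK.exists_mapClusterPt (f := atTop) (u := fun m => q (d m))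
      (tendsto_principal.2 (Eventually.of_forall hdK))
    obtain ⟨y, rfl⟩ := hsurj z
    obtain ⟨N, hN⟩ := eventually_atTop.1 (key {y} isCompact_singleton)
    have hmem : q y ∈ range fun m => q (d (m + N)) := by
      rw [← (hclosed N).closure_eq]
      refine mem_closure_iff_clusterPt.2 (ClusterPt.mono hz (tendsto_principal.2 ?_))
      filter_upwards [eventually_ge_atTop N] with m hm
      exact ⟨m - N, by simp [Nat.sub_add_cancel hm]⟩
    obtain ⟨m, hm⟩ := hmem
    exact hN (m + N) (Nat.le_add_left _ _) y rfl hm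
  · intro hc
    obtain ⟨L, hL, hsub⟩ := exists_compact_superset hc
    refine ⟨q '' L, hL.image hcont, fun u hu => ?_⟩
    by_contra hn
    obtain ⟨φ, hφ, hφu⟩ := extraction_of_frequently_atTop (not_eventually.1 hn)
    have hv : Tendsto (fun n => u (φ n)) atTop (𝓝 x) := hu.comp hφ.tendsto_atTop
    have hT : IsClosed (insert x (range fun n => u (φ n))) :=
      hv.isCompact_insert_range.isClosed
    have hS : IsClosed (range fun n => u (φ n)) := by
      rw [← hqm.isClosed_preimage]
      have h := (hT.preimage hcont).sdiff (isOpen_interior (s := L))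
      convert h using 1
      ext y
      constructor
      · rintro ⟨n, hn⟩
        exact ⟨Or.inr ⟨n, hn⟩, fun hy => hφu n ⟨y, interior_subset hy, hn.symm⟩⟩
      · rintro ⟨h1 | h1, h2⟩
        · exact absurd (hsub h1) h2
        · exact h1
    obtain ⟨n, hn⟩ := hS.mem_of_tendsto hv (Eventually.of_forall fun n => mem_range_self n)
    obtain ⟨y, rfl⟩ := hsurj x
    exact hφu n ⟨y, interior_subset (hsub rfl), hn.symm⟩
end

section
/- Let q : Y → X be a quotient map from a standard space Y to a Hausdorff space X. Then the set of points of X that are not of compact type is an F_σδ subset of X, i.e., a countable intersection of countable unions of closed subsets of X. -/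
open Filter Topology Set TopologicalSpace

universe u v w

theorem compact_sub_aux {Y : Type u} {X : Type v} [TopologicalSpace Y]
    [TopologicalSpace X] [T2Space X]
    (q : Y → X) (hq : IsQuotMap q) (E : CompactExhaustion Y) (K : Set X) (hK : IsCompact K) :
    ∃ n, K ⊆ q '' (E n) := by
  obtain ⟨hs, hc, ho⟩ := hq
  by_contra! h
  have h' : ∀ n, ∃ x, x ∈ K ∧ x ∉ q '' (E n) := fun n => Set.not_subset.1 (h n)
  choose x hxK hx using h'
  have hmem : ∀ k m y, y ∈ E m → q y = x k → k < m := by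
    intro k m y hy hk
    by_contra! hmk
    exact hx k ⟨y, E.subset hmk hy, hk⟩
  let A : ℕ → Set X := fun n => ⋃ k, if n ≤ k then {x k} else ∅
  have hA : ∀ n, IsClosed (A n) := by
    intro n
    rw [← isOpen_compl_iff, ho, preimage_compl, isOpen_compl_iff, preimage_iUnion]
    refine LocallyFinite.isClosed_iUnion ?_ ?_
    · intro y
      obtain ⟨m, hm⟩ := E.exists_mem_nhds y
      refine ⟨E m, hm, (Set.finite_Iio m).subset ?_⟩
      rintro k ⟨z, hz, hzm⟩
      by_cases hnk : n ≤ k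
      · simp only [hnk, if_true] at hz
        exact hmem k m z hzm hz
      · simp [hnk] at hz
    · intro k
      split_ifs
      · exact isClosed_singleton.preimage hc
      · simp
  have hxA : ∀ n k, n ≤ k → x k ∈ A n := by
    intro n k hnk
    refine mem_iUnion.2 ⟨k, ?_⟩
    simp [hnk]
  have hAx : ∀ n z, z ∈ A n → ∃ k, n ≤ k ∧ z = x k := by
    intro n z hz
    obtain ⟨k, hk⟩ := mem_iUnion.1 hz
    by_cases hnk : n ≤ k
    · simp only [hnk, if_true] at hk
      exact ⟨k, hnk, hk⟩
    · simp [hnk] at hk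
  have hne : (⋂ n, K ∩ A n).Nonempty := by
    refine IsCompact.nonempty_iInter_of_sequence_nonempty_isCompact_isClosed _ ?_ ?_ ?_ ?_
    · rintro n z ⟨hz, hz2⟩
      obtain ⟨k, hk, rfl⟩ := hAx _ _ hz2
      exact ⟨hz, hxA _ _ (by omega)⟩
    · exact fun n => ⟨x n, hxK n, hxA n n le_rfl⟩
    · exact hK.inter_right (hA 0)
    · exact fun n => hK.isClosed.inter (hA n)
  obtain ⟨z, hz⟩ := hne
  obtain ⟨y, rfl⟩ := hs z
  obtain ⟨m, hm⟩ := E.exists_mem y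
  obtain ⟨k, hk, hk2⟩ := hAx m _ (mem_iInter.1 hz m).2
  have := hmem k m y hm hk2
  omega

theorem statement_15 {Y : Type u} {X : Type v} [MetricSpace Y] [LocallyCompactSpace Y]
    [SeparableSpace Y] [TopologicalSpace X] [T2Space X]
    (q : Y → X) (hq : IsQuotMap q) :
    ∃ C : ℕ → ℕ → Set X, (∀ n m, IsClosed (C n m)) ∧
      {x : X | ¬ CompactType x} = ⋂ n, ⋃ m, C n m := by
  haveI : SecondCountableTopology Y := UniformSpace.secondCountable_of_separable Y
  let E : CompactExhaustion Y := default
  have hE := compact_sub_aux q hq E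
  obtain ⟨hs, hc, ho⟩ := hq
  refine ⟨fun n m => closure (q '' (E m) \ q '' (E n)), fun _ _ => isClosed_closure, ?_⟩
  ext x
  simp only [mem_setOf_eq, mem_iInter, mem_iUnion]
  constructor
  · intro hx n
    by_contra! hcon
    refine hx ⟨q '' (E n), (E.isCompact n).image hc, fun u hu => ?_⟩
    by_contra hfr
    obtain ⟨m, hm⟩ := hE _ hu.isCompact_insert_range
    refine hcon m (mem_closure_of_frequently_of_tendsto ?_ hu)
    refine (not_eventually.1 hfr).mono fun k hk => ⟨hm (Or.inr ⟨k, rfl⟩), hk⟩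
  · rintro hx ⟨K, hK, hu⟩
    obtain ⟨n, hn⟩ := hE K hK
    obtain ⟨m, hm⟩ := hx n
    have hcomp : IsCompact (closure (E m \ q ⁻¹' (q '' (E n)))) :=
      (E.isCompact m).of_isClosed_subset isClosed_closure
        (closure_minimal diff_subset (E.isCompact m).isClosed)
    have hsub : closure (q '' (E m) \ q '' (E n)) ⊆
        q '' closure (E m \ q ⁻¹' (q '' (E n))) := by
      refine closure_minimal ?_ (hcomp.image hc).isClosed
      rintro _ ⟨⟨y, hy, rfl⟩, hy2⟩
      exact ⟨y, subset_closure ⟨hy, hy2⟩, rfl⟩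
    obtain ⟨y, hy, rfl⟩ := hsub hm
    obtain ⟨s, hs1, hs2⟩ := mem_closure_iff_seq_limit.1 hy
    obtain ⟨k, hk⟩ := (hu (q ∘ s) ((hc.tendsto y).comp hs2)).exists
    exact (hs1 k).2 (hn hk)
end
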